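/- arXiv:1501.00868 — 4 statements merged into one kernel-verified Lean document; each statement's English description precedes it below -/
import Mathlib

section
/- Let the random variables {X_j, 1 ≤ j ≤ n} be associated. For subsets A and B of {1, 2, ..., n} and real numbers x_j, define H_{A,B}(x_j, j ∈ A ∪ B) = P(X_j > x_j for all j ∈ A ∪ B) − P(X_k > x_k for all k ∈ A) · P(X_l > x_l for all l ∈ B). Then 0 ≤ H_{A,B} ≤ Σ_{i ∈ A} Σ_{j ∈ B} H_{{i},{j}}. -/
open MeasureTheory ProbabilityTheory Filter Topology

noncomputable section

variable {Ω : Type*} [MeasurableSpace Ω]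

/-- Covariance of two real-valued random variables. -/
def cov (μ : Measure Ω) (f g : Ω → ℝ) : ℝ :=
  ∫ ω, f ω * g ω ∂μ - (∫ ω, f ω ∂μ) * (∫ ω, g ω ∂μ)

/-- A family of real-valued random variables is *associated* if every two coordinatewise
nondecreasing functions of any finite subcollection have nonnegative covariance
(whenever the relevant integrals exist). -/
def IsAssociated (μ : Measure Ω) {ι : Type*} (X : ι → Ω → ℝ) : Prop :=
  ∀ (S : Finset ι) (h g : (S → ℝ) → ℝ), Monotone h → Monotone g →
    Measurable h → Measurable g →
    Integrable (fun ω => h fun i => X i ω) μ →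
    Integrable (fun ω => g fun i => X i ω) μ →
    Integrable (fun ω => h (fun i => X i ω) * g (fun i => X i ω)) μ →
    0 ≤ cov μ (fun ω => h fun i => X i ω) (fun ω => g fun i => X i ω)

/-- Strict stationarity of the sequence `X 1, X 2, ...`. -/
def StrictStationary (μ : Measure Ω) (X : ℕ → Ω → ℝ) : Prop :=
  ∀ k n : ℕ, Measure.map (fun ω => fun i : Fin n => X (1 + (i : ℕ) + k) ω) μ =
    Measure.map (fun ω => fun i : Fin n => X (1 + (i : ℕ)) ω) μ

/-- Convergence in distribution to the standard normal law `N(0,1)`. -/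
def TendstoStdGaussian (μ : Measure Ω) (Z : ℕ → Ω → ℝ) : Prop :=
  ∀ f : BoundedContinuousFunction ℝ ℝ,
    Tendsto (fun n => ∫ ω, f (Z n ω) ∂μ) atTop
      (𝓝 (∫ x, f x ∂(gaussianReal 0 1)))

/-- `H_{A,B}(x) = P(X_j > x_j, j ∈ A ∪ B) − P(X_k > x_k, k ∈ A) P(X_l > x_l, l ∈ B)`. -/
def HAB {ι : Type*} [DecidableEq ι] (μ : Measure Ω) (X : ι → Ω → ℝ) (x : ι → ℝ)
    (A B : Finset ι) : ℝ :=
  (μ {ω | ∀ j ∈ A ∪ B, x j < X j ω}).toReal -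
    (μ {ω | ∀ k ∈ A, x k < X k ω}).toReal * (μ {ω | ∀ l ∈ B, x l < X l ω}).toReal

/-- The indicator of the orthant `{z | ∀ i ∈ A, x i < z i}`. -/
def orthantInd {ι : Type*} (x : ι → ℝ) (A : Finset ι) (z : ι → ℝ) : ℝ :=
  Set.indicator {z : ι → ℝ | ∀ i ∈ A, x i < z i} 1 z

/-- The number of indices `i ∈ A` with `x i < z i`. -/
def exceedanceCount {ι : Type*} (x : ι → ℝ) (A : Finset ι) (z : ι → ℝ) : ℝ :=
  ∑ i ∈ A, orthantInd x {i} z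

section Orthant

variable {ι : Type*} (x : ι → ℝ) (A : Finset ι)

lemma measurableSet_orthant : MeasurableSet {z : ι → ℝ | ∀ i ∈ A, x i < z i} := by
  have h : {z : ι → ℝ | ∀ i ∈ A, x i < z i} = ⋂ i ∈ A, {z : ι → ℝ | x i < z i} := by
    ext z; simp
  rw [h]
  exact A.measurableSet_biInter fun i _ => measurableSet_lt measurable_const (measurable_pi_apply i)

lemma measurable_orthantInd : Measurable (orthantInd x A) :=
  measurable_one.indicator (measurableSet_orthant x A)

lemma measurable_exceedanceCount : Measurable (exceedanceCount x A) :=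
  Finset.measurable_fun_sum _ fun i _ => measurable_orthantInd x {i}

lemma orthantInd_nonneg (z : ι → ℝ) : 0 ≤ orthantInd x A z :=
  Set.indicator_nonneg (fun _ _ => zero_le_one) z

lemma orthantInd_le_one (z : ι → ℝ) : orthantInd x A z ≤ 1 :=
  Set.indicator_le_self' (fun _ _ => zero_le_one) z

variable {x A} in
lemma orthantInd_eq_one {z : ι → ℝ} (hz : ∀ i ∈ A, x i < z i) : orthantInd x A z = 1 :=
  Set.indicator_of_mem (s := {z : ι → ℝ | ∀ i ∈ A, x i < z i}) hz 1

variable {x A} in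
lemma orthantInd_eq_zero {z : ι → ℝ} (hz : ¬ ∀ i ∈ A, x i < z i) : orthantInd x A z = 0 :=
  Set.indicator_of_notMem (s := {z : ι → ℝ | ∀ i ∈ A, x i < z i}) hz 1

lemma monotone_orthantInd : Monotone (orthantInd x A) := by
  intro z w hzw
  by_cases hz : ∀ i ∈ A, x i < z i
  · have hw : ∀ i ∈ A, x i < w i := fun i hi => (hz i hi).trans_le (hzw i)
    rw [orthantInd_eq_one hz, orthantInd_eq_one hw]
  · exact (orthantInd_eq_zero hz).trans_le (orthantInd_nonneg x A w)

lemma monotone_exceedanceCount : Monotone (exceedanceCount x A) :=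
  fun _ _ hzw => Finset.sum_le_sum fun i _ => monotone_orthantInd x {i} hzw

lemma monotone_exceedanceCount_sub_orthantInd :
    Monotone fun z => exceedanceCount x A z - orthantInd x A z := by
  intro z w hzw
  change exceedanceCount x A z - orthantInd x A z ≤ exceedanceCount x A w - orthantInd x A w
  by_cases hz : ∀ i ∈ A, x i < z i
  · have hw : ∀ i ∈ A, x i < w i := fun i hi => (hz i hi).trans_le (hzw i)
    linarith [monotone_exceedanceCount x A hzw, orthantInd_eq_one hz, orthantInd_eq_one hw]
  · have h0 : orthantInd x A z = 0 := orthantInd_eq_zero hz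
    by_cases hw : ∀ i ∈ A, x i < w i
    · push Not at hz
      obtain ⟨i, hi, hzi⟩ := hz
      have h1 : orthantInd x A w = 1 := orthantInd_eq_one hw
      have hiz : orthantInd x {i} z = 0 := orthantInd_eq_zero (by simpa using hzi)
      have hiw : orthantInd x {i} w = 1 := orthantInd_eq_one (by simpa using hw i hi)
      have h : orthantInd x {i} w - orthantInd x {i} z ≤
          ∑ j ∈ A, (orthantInd x {j} w - orthantInd x {j} z) :=
        Finset.single_le_sum (f := fun j => orthantInd x {j} w - orthantInd x {j} z)
          (fun j _ => sub_nonneg.2 (monotone_orthantInd x {j} hzw)) hi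
      rw [Finset.sum_sub_distrib] at h
      unfold exceedanceCount
      linarith
    · have h1 : orthantInd x A w = 0 := orthantInd_eq_zero hw
      linarith [monotone_exceedanceCount x A hzw]

end Orthant

section Covariance

variable {ι : Type*} {μ : Measure Ω} {X : ι → Ω → ℝ}

lemma integral_orthantInd (hmeas : ∀ i, Measurable (X i)) (x : ι → ℝ) (A : Finset ι) :
    ∫ ω, orthantInd x A (fun i => X i ω) ∂μ = (μ {ω | ∀ i ∈ A, x i < X i ω}).toReal :=
  integral_indicator_one (μ := μ) (s := {ω | ∀ i ∈ A, x i < X i ω})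
    ((measurable_pi_lambda (fun ω i => X i ω) hmeas) (measurableSet_orthant x A))

variable [IsProbabilityMeasure μ]

lemma memLp_orthantInd (hmeas : ∀ i, Measurable (X i)) (x : ι → ℝ) (A : Finset ι) :
    MemLp (fun ω => orthantInd x A fun i => X i ω) 2 μ :=
  MemLp.of_bound ((measurable_orthantInd x A).comp
    (measurable_pi_lambda _ hmeas)).aestronglyMeasurable 1 <| .of_forall fun ω => by
      rw [Real.norm_of_nonneg (orthantInd_nonneg x A _)]
      exact orthantInd_le_one x A _

lemma memLp_exceedanceCount (hmeas : ∀ i, Measurable (X i)) (x : ι → ℝ) (A : Finset ι) :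
    MemLp (fun ω => exceedanceCount x A fun i => X i ω) 2 μ :=
  memLp_finsetSum _ fun i _ => memLp_orthantInd hmeas x {i}

lemma orthantInd_mul_orthantInd [DecidableEq ι] (x z : ι → ℝ) (A B : Finset ι) :
    orthantInd x A z * orthantInd x B z = orthantInd x (A ∪ B) z := by
  by_cases hA : ∀ i ∈ A, x i < z i
  · by_cases hB : ∀ i ∈ B, x i < z i
    · have h : ∀ i ∈ A ∪ B, x i < z i := fun i hi =>
        (Finset.mem_union.1 hi).elim (hA i) (hB i)
      rw [orthantInd_eq_one hA, orthantInd_eq_one hB, orthantInd_eq_one h, mul_one]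
    · have h : ¬ ∀ i ∈ A ∪ B, x i < z i := fun h =>
        hB fun i hi => h i (Finset.mem_union_right A hi)
      rw [orthantInd_eq_zero hB, orthantInd_eq_zero h, mul_zero]
  · have h : ¬ ∀ i ∈ A ∪ B, x i < z i := fun h =>
      hA fun i hi => h i (Finset.mem_union_left B hi)
    rw [orthantInd_eq_zero hA, orthantInd_eq_zero h, zero_mul]

lemma HAB_eq_covariance [DecidableEq ι] (hmeas : ∀ i, Measurable (X i)) (x : ι → ℝ)
    (A B : Finset ι) :
    HAB μ X x A B = covariance (fun ω => orthantInd x A fun i => X i ω)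
      (fun ω => orthantInd x B fun i => X i ω) μ := by
  rw [covariance_eq_sub (memLp_orthantInd hmeas x A) (memLp_orthantInd hmeas x B), HAB]
  simp only [Pi.mul_apply, orthantInd_mul_orthantInd, integral_orthantInd hmeas]

lemma IsAssociated.covariance_nonneg [Fintype ι] (hassoc : IsAssociated μ X)
    {h g : (ι → ℝ) → ℝ} (hh : Monotone h) (hg : Monotone g) (hhm : Measurable h)
    (hgm : Measurable g) (hhX : MemLp (fun ω => h fun i => X i ω) 2 μ)
    (hgX : MemLp (fun ω => g fun i => X i ω) 2 μ) :
    0 ≤ covariance (fun ω => h fun i => X i ω) (fun ω => g fun i => X i ω) μ := by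
  let r : (↥(Finset.univ : Finset ι) → ℝ) → ι → ℝ := fun z i => z ⟨i, Finset.mem_univ i⟩
  have hr : Monotone r := fun z w hzw i => hzw ⟨i, Finset.mem_univ i⟩
  have hrm : Measurable r := measurable_pi_lambda _ fun i => measurable_pi_apply _
  rw [covariance_eq_sub hhX hgX]
  exact hassoc Finset.univ (h ∘ r) (g ∘ r) (hh.comp hr) (hg.comp hr) (hhm.comp hrm)
    (hgm.comp hrm) (hhX.integrable one_le_two) (hgX.integrable one_le_two)
    (hhX.integrable_mul hgX)

end Covariance

/-- **Lebowitz's inequality** (Lemma 2.3): for associated `X_1, …, X_n`,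
`0 ≤ H_{A,B} ≤ ∑_{i ∈ A} ∑_{j ∈ B} H_{{i},{j}}`. -/
theorem lebowitz_inequality (μ : Measure Ω) [IsProbabilityMeasure μ] {n : ℕ}
    (X : Fin n → Ω → ℝ) (hmeas : ∀ i, Measurable (X i))
    (hassoc : IsAssociated μ X) (A B : Finset (Fin n)) (x : Fin n → ℝ) :
    0 ≤ HAB μ X x A B ∧
      HAB μ X x A B ≤ ∑ i ∈ A, ∑ j ∈ B, HAB μ X x {i} {j} := by
  have hP := memLp_orthantInd (μ := μ) hmeas x
  have hS := memLp_exceedanceCount (μ := μ) hmeas x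
  have hSum : ∑ i ∈ A, ∑ j ∈ B, HAB μ X x {i} {j} =
      covariance (fun ω => exceedanceCount x A fun i => X i ω)
        (fun ω => exceedanceCount x B fun i => X i ω) μ := by
    simp only [HAB_eq_covariance hmeas]
    exact (covariance_fun_sum_fun_sum' (fun i _ => hP {i}) (fun j _ => hP {j})).symm
  rw [hSum, HAB_eq_covariance hmeas]
  refine ⟨hassoc.covariance_nonneg (monotone_orthantInd x A) (monotone_orthantInd x B)
    (measurable_orthantInd x A) (measurable_orthantInd x B) (hP A) (hP B), ?_⟩
  have hleft := hassoc.covariance_nonneg (monotone_exceedanceCount_sub_orthantInd x A)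
    (monotone_exceedanceCount x B)
    ((measurable_exceedanceCount x A).sub (measurable_orthantInd x A))
    (measurable_exceedanceCount x B) ((hS A).sub (hP A)) (hS B)
  have hright := hassoc.covariance_nonneg (monotone_orthantInd x A)
    (monotone_exceedanceCount_sub_orthantInd x B) (measurable_orthantInd x A)
    ((measurable_exceedanceCount x B).sub (measurable_orthantInd x B)) (hP A)
    ((hS B).sub (hP B))
  rw [covariance_fun_sub_left (hS A) (hP A) (hS B)] at hleft
  rw [covariance_fun_sub_right (hP A) (hS B) (hP B)] at hright
  linarith
end
end

section
/- Let {X_n, n ≥ 1} be a strictly stationary sequence of associated random variables with E(X_j) = 0 and |X_j| ≤ C_1 < ∞ for all j ≥ 1. Let r > 2 and assume u(n) = 2 Σ_{j=n+1}^∞ Cov(X_1, X_j) = O(n^{−(r−2)/2}). Then there is a constant B > 0, not depending on n, such that for all n ≥ 1, sup_{m ≥ 0} E|S_{n+m} − S_m|^r ≤ B n^{r/2}, where S_n = Σ_{j=1}^n X_j (and S_0 = 0). -/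
open MeasureTheory ProbabilityTheory Filter Topology

noncomputable section

variable {Ω : Type*} [MeasurableSpace Ω]

/-- Bernoulli's inequality in the form `y ^ s - x ^ s ≤ s * y ^ (s - 1) * (y - x)`. -/
theorem rpow_sub_rpow_le {x y s : ℝ} (hx : 0 ≤ x) (hxy : x ≤ y) (hs : 1 ≤ s) :
    y ^ s - x ^ s ≤ s * y ^ (s - 1) * (y - x) := by
  rcases (hx.trans hxy).eq_or_lt with h | hy
  · obtain rfl : x = y := le_antisymm hxy (h ▸ hx)
    simp
  · have h1 := one_add_mul_self_le_rpow_one_add (s := x / y - 1) (by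
      have := div_nonneg hx hy.le; linarith) hs
    rw [add_sub_cancel, Real.div_rpow hx hy.le, le_div_iff₀ (by positivity)] at h1
    have h2 : y ^ s = y ^ (s - 1) * y := by
      rw [← Real.rpow_add_one hy.ne', sub_add_cancel]
    have h3 : (1 + s * (x / y - 1)) * y ^ s = y ^ s - s * y ^ (s - 1) * (y - x) := by
      rw [h2]; field_simp; ring
    linarith

theorem add_rpow_le_of_le {x y s : ℝ} (hx : 0 ≤ x) (hxy : x ≤ y) (hs : 1 ≤ s) :
    (y + x) ^ s ≤ y ^ s + s * 2 ^ (s - 1) * (y ^ (s - 1) * x) := by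
  have h := rpow_sub_rpow_le (hx.trans hxy) (le_add_of_nonneg_right hx) hs
  have h2 : (y + x) ^ (s - 1) ≤ 2 ^ (s - 1) * y ^ (s - 1) := by
    rw [← Real.mul_rpow (by norm_num) (hx.trans hxy)]
    exact Real.rpow_le_rpow (by linarith) (by linarith) (by linarith)
  have h3 : s * (y + x) ^ (s - 1) * (y + x - y) ≤ s * (2 ^ (s - 1) * y ^ (s - 1)) * x := by
    rw [add_sub_cancel_left]
    gcongr
  linarith

theorem abs_add_rpow_le (x y : ℝ) {s : ℝ} (hs : 1 ≤ s) :
    |x + y| ^ s ≤ |x| ^ s + |y| ^ s +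
      s * 2 ^ (s - 1) * (|x| ^ (s - 1) * |y| + |x| * |y| ^ (s - 1)) := by
  have h0 : |x + y| ^ s ≤ (|x| + |y|) ^ s :=
    Real.rpow_le_rpow (abs_nonneg _) (abs_add_le x y) (by linarith)
  have hx := abs_nonneg x
  have hy := abs_nonneg y
  have hxs := Real.rpow_nonneg hx s
  have hys := Real.rpow_nonneg hy s
  have e1 : 0 ≤ s * 2 ^ (s - 1) * (|x| ^ (s - 1) * |y|) := by positivity
  have e2 : 0 ≤ s * 2 ^ (s - 1) * (|y| ^ (s - 1) * |x|) := by positivity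
  rcases le_total |x| |y| with h | h
  · have := add_rpow_le_of_le hx h hs
    rw [add_comm |y|] at this
    linarith
  · have := add_rpow_le_of_le hy h hs
    linarith

theorem abs_add_rpow_le_weighted (x y : ℝ) {s t : ℝ} (hs : 1 ≤ s) (ht0 : 0 < t) (ht1 : t < 1) :
    |x + y| ^ s ≤ (1 - t) ^ (1 - s) * |x| ^ s + t ^ (1 - s) * |y| ^ s := by
  have h0 : |x + y| ^ s ≤ (|x| + |y|) ^ s :=
    Real.rpow_le_rpow (abs_nonneg _) (abs_add_le x y) (by linarith)
  have h1t : 0 < 1 - t := by linarith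
  have h := (convexOn_rpow hs).2 (x := |x| / (1 - t)) (y := |y| / t)
    (Set.mem_Ici.2 (by positivity)) (Set.mem_Ici.2 (by positivity)) h1t.le ht0.le (by ring)
  simp only [smul_eq_mul] at h
  rw [mul_div_cancel₀ _ h1t.ne', mul_div_cancel₀ _ ht0.ne', Real.div_rpow (abs_nonneg x) h1t.le,
    Real.div_rpow (abs_nonneg y) ht0.le] at h
  have e : ∀ z : ℝ, 0 < z → ∀ w : ℝ, z * (w / z ^ s) = z ^ (1 - s) * w := by
    intro z hz w
    rw [Real.rpow_sub hz, Real.rpow_one]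
    ring
  rw [e _ h1t, e _ ht0] at h
  exact h0.trans h

/-- A form of Young's inequality. -/
theorem rpow_sub_one_mul_le {x b s η : ℝ} (hx : 0 ≤ x) (hb : 0 ≤ b) (hs : 1 < s) (hη : 0 < η) :
    x ^ (s - 1) * b ≤ η * x ^ s + η ^ (1 - s) * b ^ s := by
  have e : ∀ z : ℝ, 0 ≤ z → z ^ s = z ^ (s - 1) * z := by
    intro z hz
    rw [← Real.rpow_add_one' hz (by linarith), sub_add_cancel]
  rcases le_total b (η * x) with h | h
  · have h1 : x ^ (s - 1) * b ≤ x ^ (s - 1) * (η * x) := by gcongr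
    have h2 : 0 ≤ η ^ (1 - s) * b ^ s := by positivity
    rw [e x hx]
    linarith
  · have h1 : x ^ (s - 1) ≤ (b / η) ^ (s - 1) :=
      Real.rpow_le_rpow hx (by rw [le_div_iff₀ hη]; linarith) (by linarith)
    have h2 : 0 ≤ η * x ^ s := by positivity
    have h3 : (b / η) ^ (s - 1) = η ^ (1 - s) * b ^ (s - 1) := by
      rw [Real.div_rpow hb hη.le, ← neg_sub s 1, Real.rpow_neg hη.le]
      ring
    calc x ^ (s - 1) * b ≤ (η ^ (1 - s) * b ^ (s - 1)) * b := by rw [← h3]; gcongr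
      _ = η ^ (1 - s) * b ^ s := by rw [e b hb]; ring
      _ ≤ _ := by linarith

theorem abs_min_abs_rpow_sub_le {R s : ℝ} (hR : 0 ≤ R) (hs : 1 ≤ s) (x y : ℝ) :
    |min |x| R ^ s - min |y| R ^ s| ≤ s * R ^ (s - 1) * |x - y| := by
  have key : ∀ x y : ℝ, min |x| R ≤ min |y| R →
      min |y| R ^ s - min |x| R ^ s ≤ s * R ^ (s - 1) * |x - y| := by
    intro x y h
    have hx : 0 ≤ min |x| R := le_min (abs_nonneg x) hR
    refine (rpow_sub_rpow_le hx h hs).trans ?_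
    have h1 : min |y| R ^ (s - 1) ≤ R ^ (s - 1) :=
      Real.rpow_le_rpow (hx.trans h) (min_le_right _ _) (by linarith)
    have h2 : min |y| R - min |x| R ≤ |x - y| := by
      have h3 := abs_sub_abs_le_abs_sub y x
      rw [abs_sub_comm] at h3
      have h4 := abs_nonneg (x - y)
      rcases min_cases |x| R with h5 | h5 <;> rcases min_cases |y| R with h6 | h6 <;> linarith
    have h3 : 0 ≤ min |y| R - min |x| R := by linarith
    have h4 : 0 ≤ R ^ (s - 1) := by positivity
    gcongr
  have hmono : ∀ x y : ℝ, min |x| R ≤ min |y| R → min |x| R ^ s ≤ min |y| R ^ s := fun x y h =>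
    Real.rpow_le_rpow (le_min (abs_nonneg x) hR) h (by linarith)
  rcases le_total (min |x| R) (min |y| R) with h | h
  · rw [abs_sub_comm, abs_of_nonneg (sub_nonneg.2 (hmono _ _ h))]
    exact key x y h
  · rw [abs_of_nonneg (sub_nonneg.2 (hmono _ _ h)), abs_sub_comm x y]
    exact key y x h

/-- Solution of a doubling recursion with gaps: if `M (2 n + k)` is controlled by essentially
`2 M n`, up to a multiple of `M k` and an error `O(n ^ (r / 2))`, then `M n = O(n ^ (r / 2))`. -/
theorem exists_le_mul_rpow_of_doubling {M : ℕ → ℝ} {r C : ℝ} (hr : 2 < r) (hC : 0 ≤ C)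
    (hM : ∀ n : ℕ, M n ≤ (C * n) ^ r)
    (hrec : ∀ t : ℝ, 0 < t → t < 1 → ∀ q : ℕ, 1 ≤ q → ∃ D : ℝ, ∀ n k : ℕ, 1 ≤ n → n ≤ q * k →
      M (2 * n + k) ≤ (1 - t) ^ (1 - r) * ((2 + t) * M n + D * (n : ℝ) ^ (r / 2)) +
        t ^ (1 - r) * M k) :
    ∃ B : ℝ, 0 < B ∧ ∀ n : ℕ, 1 ≤ n → M n ≤ B * (n : ℝ) ^ (r / 2) := by
  have h2r : (2 : ℝ) < 2 ^ (r / 2) := by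
    conv_lhs => rw [← Real.rpow_one 2]
    exact Real.rpow_lt_rpow_of_exponent_lt (by norm_num) (by linarith)
  obtain ⟨t, ht0, ht1, hlam⟩ : ∃ t : ℝ, 0 < t ∧ t < 1 ∧
      (1 - t) ^ (1 - r) * (2 + t) < 2 ^ (r / 2) := by
    have hc : ContinuousAt (fun t : ℝ => (1 - t) ^ (1 - r) * (2 + t)) 0 := by
      refine ContinuousAt.mul (ContinuousAt.rpow_const (by fun_prop) (Or.inl (by norm_num)))
        (by fun_prop)
    have h1 : ∀ᶠ t in 𝓝[>] (0 : ℝ), (1 - t) ^ (1 - r) * (2 + t) < 2 ^ (r / 2) :=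
      (hc.eventually_lt continuousAt_const (by simpa using h2r)).filter_mono
        nhdsWithin_le_nhds
    have h2 : ∀ᶠ t in 𝓝[>] (0 : ℝ), t ∈ Set.Ioo (0 : ℝ) 1 := Ioo_mem_nhdsGT one_pos
    obtain ⟨t, h, ht⟩ := (h1.and h2).exists
    exact ⟨t, ht.1, ht.2, h⟩
  obtain ⟨q, hq1, hq⟩ : ∃ q : ℕ, 1 ≤ q ∧ (1 - t) ^ (1 - r) * (2 + t) +
      t ^ (1 - r) * ((2 : ℝ) / q) ^ (r / 2) < 2 ^ (r / 2) := by
    have h1 : Tendsto (fun q : ℕ => (1 - t) ^ (1 - r) * (2 + t) +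
        t ^ (1 - r) * ((2 : ℝ) / q) ^ (r / 2)) atTop
        (𝓝 ((1 - t) ^ (1 - r) * (2 + t) + t ^ (1 - r) * 0 ^ (r / 2))) :=
      (((tendsto_const_div_atTop_nhds_zero_nat 2).rpow_const
        (Or.inr (by linarith))).const_mul _).const_add _
    rw [Real.zero_rpow (by linarith), mul_zero, add_zero] at h1
    obtain ⟨q, h, hq⟩ := ((h1.eventually_lt_const hlam).and (eventually_ge_atTop 1)).exists
    exact ⟨q, hq, h⟩
  obtain ⟨D, hD⟩ := hrec t ht0 ht1 q hq1
  set lam := (1 - t) ^ (1 - r) * (2 + t) with hlamdef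
  set gam := t ^ (1 - r) * ((2 : ℝ) / q) ^ (r / 2) with hgam
  have hP : 0 < (1 - t) ^ (1 - r) := Real.rpow_pos_of_pos (by linarith) _
  have hQ : 0 < t ^ (1 - r) := Real.rpow_pos_of_pos ht0 _
  set E := (1 - t) ^ (1 - r) * D with hE
  set B := max 1 (max ((C * (100 * q : ℕ)) ^ r) (E / (2 ^ (r / 2) - (lam + gam)))) with hB
  have hB1 : 1 ≤ B := le_max_left _ _
  have hB2 : (C * (100 * q : ℕ)) ^ r ≤ B := (le_max_left _ _).trans (le_max_right _ _)
  have hB3 : E ≤ B * (2 ^ (r / 2) - (lam + gam)) := by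
    rw [← div_le_iff₀ (by linarith)]
    exact (le_max_right _ _).trans (le_max_right _ _)
  refine ⟨B, by linarith, fun N => ?_⟩
  induction N using Nat.strong_induction_on with
  | _ N ih =>
  intro hN
  rcases le_total N (100 * q) with hs | hs
  · have h1 : (1 : ℝ) ≤ (N : ℝ) ^ (r / 2) :=
      Real.one_le_rpow (by exact_mod_cast hN) (by linarith)
    have h2 : (C * N) ^ r ≤ (C * (100 * q : ℕ)) ^ r := by
      have : (N : ℝ) ≤ (100 * q : ℕ) := by exact_mod_cast hs
      exact Real.rpow_le_rpow (by positivity) (by gcongr) (by linarith)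
    nlinarith [hM N]
  · obtain ⟨n, k, hNk, hn1, hk1, hnk, hkn⟩ : ∃ n k : ℕ, N = 2 * n + k ∧ 1 ≤ n ∧ 1 ≤ k ∧
        n ≤ q * k ∧ q * k ≤ 2 * n := by
      have ha := Nat.div_mul_le_self (q * N) (2 * q + 1)
      have hb := Nat.lt_div_mul_add (a := q * N) (b := 2 * q + 1) (by lia)
      set n := q * N / (2 * q + 1)
      have h2n : 2 * n ≤ N := by nlinarith
      obtain ⟨k, hk⟩ := Nat.exists_eq_add_of_le h2n
      have hn : 3 * q ≤ n := by
        by_contra! hlt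
        have h1 : q * (100 * q) ≤ q * N := Nat.mul_le_mul_left _ hs
        have h2 : n * (2 * q + 1) ≤ 3 * q * (2 * q + 1) := Nat.mul_le_mul_right _ hlt.le
        nlinarith
      have hnk : n ≤ q * k := by rw [hk] at ha; nlinarith
      refine ⟨n, k, hk, by lia, ?_, hnk, ?_⟩
      · rcases Nat.eq_zero_or_pos k with h | h
        · subst h; lia
        · exact h
      · rw [hk] at hb; nlinarith
    have hqpos : (0 : ℝ) < q := by exact_mod_cast hq1
    have hMn := ih n (by lia) hn1
    have hMk := ih k (by lia) hk1
    have hkle : (k : ℝ) ^ (r / 2) ≤ ((2 : ℝ) / q) ^ (r / 2) * (n : ℝ) ^ (r / 2) := by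
      rw [← Real.mul_rpow (by positivity) (by positivity)]
      refine Real.rpow_le_rpow (by positivity) ?_ (by linarith)
      rw [div_mul_eq_mul_div, le_div_iff₀ hqpos, mul_comm]
      exact_mod_cast hkn
    have hNge : 2 ^ (r / 2) * (n : ℝ) ^ (r / 2) ≤ (N : ℝ) ^ (r / 2) := by
      rw [← Real.mul_rpow (by positivity) (by positivity)]
      refine Real.rpow_le_rpow (by positivity) ?_ (by linarith)
      rw [hNk]; push_cast; linarith [(Nat.cast_nonneg k : (0 : ℝ) ≤ k)]
    have hnp : (0 : ℝ) ≤ (n : ℝ) ^ (r / 2) := by positivity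
    calc M N ≤ lam * M n + E * (n : ℝ) ^ (r / 2) + t ^ (1 - r) * M k := by
          have := hD n k hn1 hnk
          rw [← hNk] at this
          rw [hlamdef, hE]; linarith
      _ ≤ lam * (B * (n : ℝ) ^ (r / 2)) + E * (n : ℝ) ^ (r / 2) +
            t ^ (1 - r) * (B * (((2 : ℝ) / q) ^ (r / 2) * (n : ℝ) ^ (r / 2))) := by
          have hl : 0 ≤ lam := by positivity
          have := hMk.trans (mul_le_mul_of_nonneg_left hkle (by linarith : 0 ≤ B))
          gcongr
      _ = (B * (lam + gam) + E) * (n : ℝ) ^ (r / 2) := by rw [hgam]; ring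
      _ ≤ (B * 2 ^ (r / 2)) * (n : ℝ) ^ (r / 2) := by
          gcongr; linarith
      _ ≤ B * (N : ℝ) ^ (r / 2) := by
          rw [mul_assoc]; gcongr

theorem integrable_of_abs_le {μ : Measure Ω} [IsFiniteMeasure μ] {f : Ω → ℝ} (hf : Measurable f)
    {C : ℝ} (hC : ∀ ω, |f ω| ≤ C) : Integrable f μ :=
  Integrable.of_bound hf.aestronglyMeasurable C (ae_of_all _ hC)

theorem integrable_mul_of_abs_le {μ : Measure Ω} [IsFiniteMeasure μ] {f g : Ω → ℝ}
    (hf : Measurable f) (hg : Measurable g) {C D : ℝ} (hC : ∀ ω, |f ω| ≤ C) (hD : ∀ ω, |g ω| ≤ D) :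
    Integrable (fun ω => f ω * g ω) μ :=
  integrable_of_abs_le (hf.mul hg) (C := C * D) fun ω => by
    rw [abs_mul]
    exact mul_le_mul (hC ω) (hD ω) (abs_nonneg _) ((abs_nonneg _).trans (hC ω))

theorem Monotone.abs_comp_le {φ : ℝ → ℝ} (hφ : Monotone φ) {R x : ℝ} (hx : |x| ≤ R) :
    |φ x| ≤ max |φ (-R)| |φ R| := by
  exact abs_le_max_abs_abs (hφ (abs_le.1 hx).1) (hφ (abs_le.1 hx).2)

/-- Monotone functions of bounded partial sums of an associated family have nonnegative
covariance. -/
theorem IsAssociated.cov_comp_sum_nonneg {ι : Type*} [DecidableEq ι] {μ : Measure Ω}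
    [IsFiniteMeasure μ] {X : ι → Ω → ℝ} (hX : IsAssociated μ X) (hmeas : ∀ i, Measurable (X i))
    {A B : Finset ι} {R : ℝ} (hA : ∀ ω, |∑ i ∈ A, X i ω| ≤ R) (hB : ∀ ω, |∑ i ∈ B, X i ω| ≤ R)
    {φ ψ : ℝ → ℝ} (hφ : Monotone φ) (hψ : Monotone ψ) :
    0 ≤ cov μ (fun ω => φ (∑ i ∈ A, X i ω)) (fun ω => ψ (∑ i ∈ B, X i ω)) := by
  have hmA : Measurable fun ω => ∑ i ∈ A, X i ω := by fun_prop
  have hmB : Measurable fun ω => ∑ i ∈ B, X i ω := by fun_prop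
  have sum_eq : ∀ D ⊆ A ∪ B, ∀ ω,
      ∑ i : ↥(A ∪ B), (if (i : ι) ∈ D then X i ω else 0) = ∑ i ∈ D, X i ω := by
    intro D hD ω
    rw [Finset.sum_coe_sort (A ∪ B) fun i => if i ∈ D then X i ω else 0, Finset.sum_ite_mem,
      Finset.inter_eq_right.2 hD]
  have mono : ∀ D : Finset ι, Monotone fun v : ↥(A ∪ B) → ℝ =>
      ∑ i : ↥(A ∪ B), (if (i : ι) ∈ D then v i else 0) := by
    intro D v w hvw
    refine Finset.sum_le_sum fun i _ => ?_
    split_ifs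
    exacts [hvw i, le_rfl]
  have meas : ∀ D : Finset ι, Measurable fun v : ↥(A ∪ B) → ℝ =>
      ∑ i : ↥(A ∪ B), (if (i : ι) ∈ D then v i else 0) := by
    intro D
    refine Finset.measurable_sum _ fun i _ => ?_
    split_ifs
    exacts [measurable_pi_apply i, measurable_const]
  have h := hX (A ∪ B)
    (fun v => φ (∑ i : ↥(A ∪ B), (if (i : ι) ∈ A then v i else 0)))
    (fun v => ψ (∑ i : ↥(A ∪ B), (if (i : ι) ∈ B then v i else 0)))
    (hφ.comp (mono A)) (hψ.comp (mono B)) (hφ.measurable.comp (meas A))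
    (hψ.measurable.comp (meas B))
  simp only [sum_eq A Finset.subset_union_left, sum_eq B Finset.subset_union_right] at h
  exact h (integrable_of_abs_le (hφ.measurable.comp hmA) fun ω => hφ.abs_comp_le (hA ω))
    (integrable_of_abs_le (hψ.measurable.comp hmB) fun ω => hψ.abs_comp_le (hB ω))
    (integrable_mul_of_abs_le (hφ.measurable.comp hmA) (hψ.measurable.comp hmB)
      (fun ω => hφ.abs_comp_le (hA ω)) (fun ω => hψ.abs_comp_le (hB ω)))

theorem monotone_const_mul_add {f : ℝ → ℝ} {L : ℝ} (hf : ∀ x y, |f x - f y| ≤ L * |x - y|) :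
    Monotone fun x => L * x + f x := by
  intro x y hxy
  have h := (abs_le.1 (hf y x)).1
  rw [abs_of_nonneg (sub_nonneg.2 hxy)] at h
  dsimp only
  linarith

/-- If monotone functions of the bounded variables `S`, `T` have nonnegative covariance, then the
covariance of Lipschitz functions of `S` and `T` is controlled by that of `S` and `T`. -/
theorem cov_comp_le_of_lipschitz {μ : Measure Ω} [IsProbabilityMeasure μ] {S T : Ω → ℝ}
    (hS : Measurable S) (hT : Measurable T) {R : ℝ} (hSR : ∀ ω, |S ω| ≤ R)
    (hTR : ∀ ω, |T ω| ≤ R)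
    (hST : ∀ φ ψ : ℝ → ℝ, Monotone φ → Monotone ψ →
      0 ≤ cov μ (fun ω => φ (S ω)) (fun ω => ψ (T ω)))
    {f g : ℝ → ℝ} {L K : ℝ} (hf : ∀ x y, |f x - f y| ≤ L * |x - y|)
    (hg : ∀ x y, |g x - g y| ≤ K * |x - y|) :
    cov μ (fun ω => f (S ω)) (fun ω => g (T ω)) ≤ L * K * cov μ S T := by
  have hf' : ∀ x y, |-f x - -f y| ≤ L * |x - y| := fun x y => by
    rw [neg_sub_neg, abs_sub_comm]; exact hf x y
  have hg' : ∀ x y, |-g x - -g y| ≤ K * |x - y| := fun x y => by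
    rw [neg_sub_neg, abs_sub_comm]; exact hg x y
  have h1 := hST _ _ (monotone_const_mul_add hf) (monotone_const_mul_add hg')
  have h2 := hST _ _ (monotone_const_mul_add hf') (monotone_const_mul_add hg)
  have meas_of_lip : ∀ {f : ℝ → ℝ} {L : ℝ}, (∀ x y, |f x - f y| ≤ L * |x - y|) → Measurable f := by
    intro f L h
    have := (monotone_const_mul_add h).measurable.sub (measurable_id.const_mul L)
    convert this using 1
    ext x
    simp
  have bound : ∀ {f : ℝ → ℝ} {L : ℝ}, (∀ x y, |f x - f y| ≤ L * |x - y|) →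
      ∀ x, |x| ≤ R → |f x| ≤ |f 0| + |L| * R := by
    intro f L h x hx
    have h3 := h x 0
    rw [sub_zero] at h3
    have h4 : L * |x| ≤ |L| * R :=
      mul_le_mul (le_abs_self L) hx (abs_nonneg _) (abs_nonneg _)
    have h5 := abs_sub_abs_le_abs_sub (f x) (f 0)
    linarith
  have mF := (meas_of_lip hf).comp hS
  have mG := (meas_of_lip hg).comp hT
  have bF : ∀ ω, |(f ∘ S) ω| ≤ _ := fun ω => bound hf _ (hSR ω)
  have bG : ∀ ω, |(g ∘ T) ω| ≤ _ := fun ω => bound hg _ (hTR ω)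
  have memS : MemLp S 2 μ := MemLp.of_bound hS.aestronglyMeasurable R (ae_of_all _ hSR)
  have memT : MemLp T 2 μ := MemLp.of_bound hT.aestronglyMeasurable R (ae_of_all _ hTR)
  have memF : MemLp (f ∘ S) 2 μ := MemLp.of_bound mF.aestronglyMeasurable _ (ae_of_all _ bF)
  have memG : MemLp (g ∘ T) 2 μ := MemLp.of_bound mG.aestronglyMeasurable _ (ae_of_all _ bG)
  have cov_eq : ∀ {Y Z : Ω → ℝ}, MemLp Y 2 μ → MemLp Z 2 μ → cov μ Y Z = covariance Y Z μ :=
    fun hY hZ => (covariance_eq_sub hY hZ).symm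
  have e1 : cov μ (fun ω => L * S ω + f (S ω)) (fun ω => K * T ω + -g (T ω)) =
      L * K * covariance S T μ - L * covariance S (g ∘ T) μ + K * covariance (f ∘ S) T μ -
        covariance (f ∘ S) (g ∘ T) μ := by
    have : (fun ω => L * S ω + f (S ω)) = L • S + f ∘ S := rfl
    rw [this]
    have : (fun ω => K * T ω + -g (T ω)) = K • T - g ∘ T := by
      ext ω; simp [sub_eq_add_neg]
    rw [this, cov_eq ((memS.const_smul L).add memF) ((memT.const_smul K).sub memG),
      covariance_add_left (memS.const_smul L) memF ((memT.const_smul K).sub memG),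
      covariance_sub_right (memS.const_smul L) (memT.const_smul K) memG,
      covariance_sub_right memF (memT.const_smul K) memG]
    simp only [covariance_smul_left, covariance_smul_right]
    ring
  have e2 : cov μ (fun ω => L * S ω + -f (S ω)) (fun ω => K * T ω + g (T ω)) =
      L * K * covariance S T μ + L * covariance S (g ∘ T) μ - K * covariance (f ∘ S) T μ -
        covariance (f ∘ S) (g ∘ T) μ := by
    have : (fun ω => L * S ω + -f (S ω)) = L • S - f ∘ S := by
      ext ω; simp [sub_eq_add_neg]
    rw [this]
    have : (fun ω => K * T ω + g (T ω)) = K • T + g ∘ T := rfl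
    rw [this, cov_eq ((memS.const_smul L).sub memF) ((memT.const_smul K).add memG),
      covariance_sub_left (memS.const_smul L) memF ((memT.const_smul K).add memG),
      covariance_add_right (memS.const_smul L) (memT.const_smul K) memG,
      covariance_add_right memF (memT.const_smul K) memG]
    simp only [covariance_smul_left, covariance_smul_right]
    ring
  rw [e1] at h1
  rw [e2] at h2
  have e3 : cov μ (fun ω => f (S ω)) (fun ω => g (T ω)) = covariance (f ∘ S) (g ∘ T) μ :=
    cov_eq memF memG
  rw [e3, cov_eq memS memT]
  linarith

/-- The sum of the `n` consecutive variables `X (m + 1), ..., X (m + n)`. -/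
def blockSum {α : Type*} (X : ℕ → α → ℝ) (m n : ℕ) (ω : α) : ℝ :=
  ∑ j ∈ Finset.Ico (m + 1) (m + 1 + n), X j ω

theorem blockSum_add {α : Type*} (X : ℕ → α → ℝ) (m n k : ℕ) (ω : α) :
    blockSum X m (n + k) ω = blockSum X m n ω + blockSum X (m + n) k ω := by
  unfold blockSum
  rw [← Finset.sum_Ico_consecutive (fun j => X j ω) (show m + 1 ≤ m + 1 + n by lia)
    (show m + 1 + n ≤ m + 1 + (n + k) by lia)]
  congr 2
  congr 1 <;> lia

theorem abs_blockSum_le {α : Type*} {X : ℕ → α → ℝ} {C : ℝ}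
    (hbdd : ∀ j : ℕ, 1 ≤ j → ∀ ω, |X j ω| ≤ C) (m n : ℕ) (ω : α) : |blockSum X m n ω| ≤ C * n := by
  refine (Finset.abs_sum_le_sum_abs _ _).trans ((Finset.sum_le_card_nsmul _ _ C fun j hj =>
    hbdd j (by rw [Finset.mem_Ico] at hj; lia) ω).trans_eq ?_)
  rw [Nat.card_Ico, add_tsub_cancel_left, nsmul_eq_mul, mul_comm]

theorem measurable_blockSum {X : ℕ → Ω → ℝ} (hmeas : ∀ j, Measurable (X j)) (m n : ℕ) :
    Measurable (blockSum X m n) := by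
  unfold blockSum; fun_prop

theorem StrictStationary.integral_comp {μ : Measure Ω} {X : ℕ → Ω → ℝ}
    (h : StrictStationary μ X) (hmeas : ∀ j, Measurable (X j)) (k n : ℕ)
    {F : (Fin n → ℝ) → ℝ} (hF : Measurable F) :
    ∫ ω, F (fun i => X (1 + (i : ℕ) + k) ω) ∂μ = ∫ ω, F (fun i => X (1 + (i : ℕ)) ω) ∂μ := by
  rw [← integral_map (f := F) (φ := fun ω => fun i : Fin n => X (1 + (i : ℕ) + k) ω)
    (by fun_prop) hF.aestronglyMeasurable, h k n,
    integral_map (by fun_prop) hF.aestronglyMeasurable]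

theorem StrictStationary.integral_comp_blockSum {μ : Measure Ω} {X : ℕ → Ω → ℝ}
    (h : StrictStationary μ X) (hmeas : ∀ j, Measurable (X j)) (m n : ℕ)
    {φ : ℝ → ℝ} (hφ : Measurable φ) :
    ∫ ω, φ (blockSum X m n ω) ∂μ = ∫ ω, φ (blockSum X 0 n ω) ∂μ := by
  have e : ∀ k ω, blockSum X k n ω = ∑ i : Fin n, X (1 + (i : ℕ) + k) ω := by
    intro k ω
    rw [blockSum, Finset.sum_Ico_eq_sum_range, add_tsub_cancel_left, Finset.sum_range]
    refine Finset.sum_congr rfl fun i _ => ?_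
    congr 1; lia
  simp only [e]
  exact h.integral_comp hmeas m n (F := fun v => φ (∑ i, v i)) (by fun_prop)

theorem StrictStationary.integral_mul {μ : Measure Ω} {X : ℕ → Ω → ℝ}
    (h : StrictStationary μ X) (hmeas : ∀ j, Measurable (X j)) (k d : ℕ) :
    ∫ ω, X (1 + k) ω * X (1 + d + k) ω ∂μ = ∫ ω, X 1 ω * X (1 + d) ω ∂μ := by
  simpa using h.integral_comp hmeas k (d + 1)
    (F := fun v => v 0 * v (Fin.last d)) (by fun_prop)

/-- Moment bound for the sum of two weakly dependent variables with equal moments. -/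
theorem integral_abs_add_rpow_le {μ : Measure Ω} [IsProbabilityMeasure μ] {S T : Ω → ℝ}
    (hS : Measurable S) (hT : Measurable T) {R : ℝ} (hR : 0 ≤ R) (hSR : ∀ ω, |S ω| ≤ R)
    (hTR : ∀ ω, |T ω| ≤ R)
    (hST : ∀ φ ψ : ℝ → ℝ, Monotone φ → Monotone ψ →
      0 ≤ cov μ (fun ω => φ (S ω)) (fun ω => ψ (T ω)))
    (heq : ∀ s : ℝ, ∫ ω, |T ω| ^ s ∂μ = ∫ ω, |S ω| ^ s ∂μ)
    {b : ℝ} (hb : ∫ ω, |S ω| ∂μ ≤ b) {r η : ℝ} (hr : 2 < r) (hη : 0 < η) :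
    ∫ ω, |S ω + T ω| ^ r ∂μ ≤ (2 + 2 * (r * 2 ^ (r - 1)) * η) * ∫ ω, |S ω| ^ r ∂μ +
      2 * (r * 2 ^ (r - 1)) * (η ^ (1 - r) * b ^ r + (r - 1) * R ^ (r - 2) * cov μ S T) := by
  have habs : ∀ x y : ℝ, |(|x| - |y|)| ≤ 1 * |x - y| := fun x y => by
    rw [one_mul]; exact abs_abs_sub_abs_le_abs_sub x y
  have hpow := abs_min_abs_rpow_sub_le hR (show 1 ≤ r - 1 by linarith)
  have h1 := cov_comp_le_of_lipschitz hS hT hSR hTR hST hpow habs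
  have h2 := cov_comp_le_of_lipschitz hS hT hSR hTR hST habs hpow
  have eS : ∀ ω, min |S ω| R = |S ω| := fun ω => min_eq_left (hSR ω)
  have eT : ∀ ω, min |T ω| R = |T ω| := fun ω => min_eq_left (hTR ω)
  have e2 : r - 1 - 1 = r - 2 := by ring
  simp only [eS, eT, e2, mul_one, one_mul] at h1 h2
  unfold cov at h1 h2
  have hb1 : ∫ ω, |T ω| ∂μ ≤ b := by
    have := heq 1
    simp only [Real.rpow_one] at this
    rwa [this]
  have hb0 : 0 ≤ b := (integral_nonneg fun ω => abs_nonneg (S ω)).trans hb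
  have bd : ∀ {Y : Ω → ℝ}, (∀ ω, |Y ω| ≤ R) → ∀ s : ℝ, 0 ≤ s → ∀ ω, |(|Y ω| ^ s)| ≤ R ^ s := by
    intro Y hY s hs ω
    rw [abs_of_nonneg (by positivity)]
    exact Real.rpow_le_rpow (abs_nonneg _) (hY ω) hs
  have bd1 : ∀ {Y : Ω → ℝ}, (∀ ω, |Y ω| ≤ R) → ∀ ω, |(|Y ω|)| ≤ R := by
    intro Y hY ω
    rw [abs_abs]
    exact hY ω
  have int_pow : ∀ {Y : Ω → ℝ}, Measurable Y → (∀ ω, |Y ω| ≤ R) → ∀ s : ℝ, 0 ≤ s →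
      Integrable (fun ω => |Y ω| ^ s) μ := fun hY hYR s hs =>
    integrable_of_abs_le (by fun_prop) (bd hYR s hs)
  have i1 : Integrable (fun ω => |S ω| ^ (r - 1) * |T ω|) μ :=
    integrable_mul_of_abs_le (by fun_prop) (by fun_prop) (bd hSR _ (by linarith)) (bd1 hTR)
  have i2 : Integrable (fun ω => |S ω| * |T ω| ^ (r - 1)) μ :=
    integrable_mul_of_abs_le (by fun_prop) (by fun_prop) (bd1 hSR) (bd hTR _ (by linarith))
  have iS := int_pow hS hSR r (by linarith)
  have iT := int_pow hT hTR r (by linarith)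
  have young : (∫ ω, |S ω| ^ (r - 1) ∂μ) * b ≤ η * ∫ ω, |S ω| ^ r ∂μ + η ^ (1 - r) * b ^ r := by
    calc (∫ ω, |S ω| ^ (r - 1) ∂μ) * b = ∫ ω, |S ω| ^ (r - 1) * b ∂μ :=
          (integral_mul_const _ _).symm
      _ ≤ ∫ ω, (η * |S ω| ^ r + η ^ (1 - r) * b ^ r) ∂μ :=
          integral_mono ((int_pow hS hSR _ (by linarith)).mul_const _)
            ((iS.const_mul _).add (integrable_const _)) fun ω =>
              rpow_sub_one_mul_le (abs_nonneg _) hb0 (by linarith) hη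
      _ = _ := by
          rw [integral_add (iS.const_mul _) (integrable_const _), integral_const_mul]
          simp
  have hp0 : 0 ≤ ∫ ω, |S ω| ^ (r - 1) ∂μ := integral_nonneg fun ω => by positivity
  have g1 : (∫ ω, |S ω| ^ (r - 1) ∂μ) * ∫ ω, |T ω| ∂μ ≤ (∫ ω, |S ω| ^ (r - 1) ∂μ) * b := by gcongr
  have g2 : (∫ ω, |S ω| ∂μ) * ∫ ω, |T ω| ^ (r - 1) ∂μ ≤ (∫ ω, |S ω| ^ (r - 1) ∂μ) * b := by
    rw [heq, mul_comm]; gcongr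
  have main : ∫ ω, |S ω + T ω| ^ r ∂μ ≤ ∫ ω, |S ω| ^ r ∂μ + ∫ ω, |T ω| ^ r ∂μ +
      r * 2 ^ (r - 1) * (∫ ω, |S ω| ^ (r - 1) * |T ω| ∂μ + ∫ ω, |S ω| * |T ω| ^ (r - 1) ∂μ) := by
    have i3 : Integrable (fun ω => |S ω| ^ r + |T ω| ^ r) μ := iS.add iT
    have i4 : Integrable (fun ω => r * 2 ^ (r - 1) *
        (|S ω| ^ (r - 1) * |T ω| + |S ω| * |T ω| ^ (r - 1))) μ := (i1.add i2).const_mul _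
    rw [← integral_add iS iT, ← integral_add i1 i2, ← integral_const_mul, ← integral_add i3 i4]
    refine integral_mono_of_nonneg (ae_of_all _ fun ω => by positivity)
      (i3.add i4) (ae_of_all _ fun ω => ?_)
    exact abs_add_rpow_le _ _ (by linarith)
  rw [heq r] at main
  have hK : 0 ≤ r * 2 ^ (r - 1) := by positivity
  have fin := mul_le_mul_of_nonneg_left (add_le_add
    (show ∫ ω, |S ω| ^ (r - 1) * |T ω| ∂μ ≤ η * ∫ ω, |S ω| ^ r ∂μ + η ^ (1 - r) * b ^ r +
      (r - 1) * R ^ (r - 2) * cov μ S T by unfold cov; linarith)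
    (show ∫ ω, |S ω| * |T ω| ^ (r - 1) ∂μ ≤ η * ∫ ω, |S ω| ^ r ∂μ + η ^ (1 - r) * b ^ r +
      (r - 1) * R ^ (r - 2) * cov μ S T by unfold cov; linarith)) hK
  linarith

/-- The covariance sequence of a bounded centered stationary associated sequence is nonnegative. -/
theorem IsAssociated.integral_mul_nonneg {μ : Measure Ω} [IsProbabilityMeasure μ]
    {X : ℕ → Ω → ℝ} (hassoc : IsAssociated μ X) (hmeas : ∀ j, Measurable (X j))
    (hmean : ∀ j : ℕ, 1 ≤ j → ∫ ω, X j ω ∂μ = 0) {C : ℝ}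
    (hbdd : ∀ j : ℕ, 1 ≤ j → ∀ ω, |X j ω| ≤ C) (d : ℕ) :
    0 ≤ ∫ ω, X 1 ω * X (1 + d) ω ∂μ := by
  have h := hassoc.cov_comp_sum_nonneg hmeas (A := {1}) (B := {1 + d}) (R := C)
    (by simpa using hbdd 1 le_rfl) (by simpa using hbdd (1 + d) (by lia)) monotone_id monotone_id
  simpa [cov, hmean 1 le_rfl] using h

theorem integral_blockSum_mul_le {μ : Measure Ω} [IsProbabilityMeasure μ] {X : ℕ → Ω → ℝ}
    (hmeas : ∀ j, Measurable (X j)) (hstat : StrictStationary μ X) {C : ℝ}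
    (hbdd : ∀ j : ℕ, 1 ≤ j → ∀ ω, |X j ω| ≤ C)
    (hpos : ∀ d : ℕ, 0 ≤ ∫ ω, X 1 ω * X (1 + d) ω ∂μ)
    (hsum : Summable fun d : ℕ => ∫ ω, X 1 ω * X (1 + d) ω ∂μ) (i d n : ℕ) :
    ∫ ω, X (1 + i) ω * blockSum X (i + d) n ω ∂μ ≤
      ∑' l : ℕ, ∫ ω, X 1 ω * X (1 + (d + l)) ω ∂μ := by
  have hs : Summable fun l : ℕ => ∫ ω, X 1 ω * X (1 + (d + l)) ω ∂μ := by
    simpa only [add_comm d] using (summable_nat_add_iff d).2 hsum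
  calc ∫ ω, X (1 + i) ω * blockSum X (i + d) n ω ∂μ
      = ∑ l ∈ Finset.range n, ∫ ω, X 1 ω * X (1 + (d + l)) ω ∂μ := by
        simp only [blockSum, Finset.mul_sum]
        rw [integral_finsetSum _ fun j hj => integrable_mul_of_abs_le (hmeas _) (hmeas _)
          (hbdd _ (by lia)) (hbdd j (by rw [Finset.mem_Ico] at hj; lia)),
          Finset.sum_Ico_eq_sum_range, add_tsub_cancel_left]
        refine Finset.sum_congr rfl fun l _ => ?_
        rw [← hstat.integral_mul hmeas i (d + l), show i + d + 1 + l = 1 + (d + l) + i by ring]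
    _ ≤ _ := hs.sum_le_tsum _ fun l _ => hpos _

/-- The variance of a partial sum grows at most linearly. -/
theorem integral_blockSum_sq_le {μ : Measure Ω} [IsProbabilityMeasure μ] {X : ℕ → Ω → ℝ}
    (hmeas : ∀ j, Measurable (X j)) (hstat : StrictStationary μ X) {C : ℝ}
    (hbdd : ∀ j : ℕ, 1 ≤ j → ∀ ω, |X j ω| ≤ C)
    (hpos : ∀ d : ℕ, 0 ≤ ∫ ω, X 1 ω * X (1 + d) ω ∂μ)
    (hsum : Summable fun d : ℕ => ∫ ω, X 1 ω * X (1 + d) ω ∂μ) (n : ℕ) :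
    ∫ ω, blockSum X 0 n ω ^ 2 ∂μ ≤ 2 * (∑' d : ℕ, ∫ ω, X 1 ω * X (1 + d) ω ∂μ) * n := by
  induction n with
  | zero => simp [blockSum]
  | succ n ih =>
    have m1 : Measurable (X 1) := hmeas 1
    have mB := measurable_blockSum hmeas 1 n
    have h0 : ∀ ω, blockSum X 0 (n + 1) ω = X 1 ω + blockSum X 1 n ω := by
      intro ω
      rw [add_comm n 1, blockSum_add]
      simp [blockSum]
    have h1 := integral_blockSum_mul_le hmeas hstat hbdd hpos hsum 0 0 1
    have h2 := integral_blockSum_mul_le hmeas hstat hbdd hpos hsum 0 1 n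
    have e1 : ∀ ω, blockSum X 0 1 ω = X 1 ω := by simp [blockSum]
    simp only [add_zero, zero_add, e1] at h1 h2
    have h3 := hstat.integral_comp_blockSum hmeas 1 n (φ := fun x => x ^ 2) (by fun_prop)
    have b1 := hbdd 1 le_rfl
    have bB := abs_blockSum_le hbdd 1 n
    have i1 : Integrable (fun ω => X 1 ω * X 1 ω) μ := integrable_mul_of_abs_le m1 m1 b1 b1
    have i2 : Integrable (fun ω => X 1 ω * blockSum X 1 n ω) μ :=
      integrable_mul_of_abs_le m1 mB b1 bB
    have i3 : Integrable (fun ω => blockSum X 1 n ω ^ 2) μ := by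
      simpa only [sq] using integrable_mul_of_abs_le mB mB bB bB
    have h4 : ∫ ω, blockSum X 0 (n + 1) ω ^ 2 ∂μ = ∫ ω, X 1 ω * X 1 ω ∂μ +
        2 * ∫ ω, X 1 ω * blockSum X 1 n ω ∂μ + ∫ ω, blockSum X 1 n ω ^ 2 ∂μ := by
      have i4 : Integrable (fun ω => X 1 ω * X 1 ω + 2 * (X 1 ω * blockSum X 1 n ω)) μ :=
        i1.add (i2.const_mul 2)
      rw [← integral_const_mul, ← integral_add i1 (i2.const_mul 2), ← integral_add i4 i3]
      refine integral_congr_ae (ae_of_all _ fun ω => ?_)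
      simp only [h0]
      ring
    have h5 := hsum.tsum_eq_zero_add
    have h6 := hpos 0
    simp only [add_zero] at h5 h6
    have h7 : ∑' l : ℕ, ∫ ω, X 1 ω * X (1 + (1 + l)) ω ∂μ =
        ∑' l : ℕ, ∫ ω, X 1 ω * X (1 + (l + 1)) ω ∂μ := by simp only [add_comm 1]
    push_cast
    rw [h4, h3]
    linarith

theorem integral_abs_blockSum_le {μ : Measure Ω} [IsProbabilityMeasure μ] {X : ℕ → Ω → ℝ}
    (hmeas : ∀ j, Measurable (X j)) {C : ℝ} (hbdd : ∀ j : ℕ, 1 ≤ j → ∀ ω, |X j ω| ≤ C)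
    {V : ℝ} {n : ℕ} (hn : 1 ≤ n) (hV : ∫ ω, blockSum X 0 n ω ^ 2 ∂μ ≤ V * n) :
    ∫ ω, |blockSum X 0 n ω| ∂μ ≤ (V + 1) * √n := by
  have mB := measurable_blockSum hmeas 0 n
  have bB := abs_blockSum_le hbdd 0 n
  have i3 : Integrable (fun ω => blockSum X 0 n ω ^ 2) μ := by
    simpa only [sq] using integrable_mul_of_abs_le mB mB bB bB
  have hnpos : (0 : ℝ) < n := by exact_mod_cast hn
  have hs : 0 < √(n : ℝ) := Real.sqrt_pos.2 hnpos
  have hsq := Real.mul_self_sqrt hnpos.le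
  have h1 : (∫ ω, |blockSum X 0 n ω| ∂μ) * √n ≤ ∫ ω, (blockSum X 0 n ω ^ 2 + n) ∂μ := by
    rw [← integral_mul_const]
    refine integral_mono ((integrable_of_abs_le mB bB).abs.mul_const _)
      (i3.add (integrable_const _)) fun ω => ?_
    dsimp only
    rw [← sq_abs]
    nlinarith [sq_nonneg (|blockSum X 0 n ω| - √n), sq_nonneg (|blockSum X 0 n ω|)]
  rw [integral_add i3 (integrable_const _)] at h1
  simp only [integral_const, probReal_univ, one_smul] at h1
  rw [← mul_le_mul_iff_left₀ hs, mul_assoc, hsq]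
  linarith

/-- The covariance of two blocks of length `n` separated by a gap `k`. -/
theorem integral_blockSum_mul_blockSum_le {μ : Measure Ω} [IsProbabilityMeasure μ]
    {X : ℕ → Ω → ℝ} (hmeas : ∀ j, Measurable (X j)) (hstat : StrictStationary μ X) {C : ℝ}
    (hbdd : ∀ j : ℕ, 1 ≤ j → ∀ ω, |X j ω| ≤ C)
    (hpos : ∀ d : ℕ, 0 ≤ ∫ ω, X 1 ω * X (1 + d) ω ∂μ)
    (hsum : Summable fun d : ℕ => ∫ ω, X 1 ω * X (1 + d) ω ∂μ) {K e : ℝ} (hK : 0 ≤ K) (he : 0 ≤ e)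
    (hu : ∀ d : ℕ, 1 ≤ d →
      ∑' l : ℕ, ∫ ω, X 1 ω * X (1 + (d + l)) ω ∂μ ≤ K * (d : ℝ) ^ (-e))
    (n : ℕ) {k : ℕ} (hk : 1 ≤ k) :
    ∫ ω, blockSum X 0 n ω * blockSum X (n + k) n ω ∂μ ≤ n * (K * (k : ℝ) ^ (-e)) := by
  have e1 : ∀ ω, blockSum X 0 n ω * blockSum X (n + k) n ω =
      ∑ i ∈ Finset.range n, X (1 + i) ω * blockSum X (n + k) n ω := by
    intro ω
    rw [← Finset.sum_mul, blockSum, Finset.sum_Ico_eq_sum_range]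
    simp
  simp only [e1]
  rw [integral_finsetSum _ fun i _ => integrable_mul_of_abs_le (hmeas _)
    (measurable_blockSum hmeas _ _) (hbdd _ (by lia)) (abs_blockSum_le hbdd _ _)]
  refine (Finset.sum_le_card_nsmul _ _ (K * (k : ℝ) ^ (-e)) fun i hi => ?_).trans_eq ?_
  · rw [Finset.mem_range] at hi
    have h1 := integral_blockSum_mul_le hmeas hstat hbdd hpos hsum i (n + k - i) n
    rw [show i + (n + k - i) = n + k by lia] at h1
    refine (h1.trans (hu _ (by lia))).trans ?_
    have : (k : ℝ) ≤ ((n + k - i : ℕ) : ℝ) := by exact_mod_cast (by lia)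
    have hk0 : (0 : ℝ) < k := by exact_mod_cast hk
    exact mul_le_mul_of_nonneg_left
      (Real.rpow_le_rpow_of_nonpos hk0 this (by linarith)) hK
  · simp

/-- **Birkel's moment bound** (Lemma 2.8): for a stationary associated sequence with mean
zero and `|X_j| ≤ C₁`, if `u(n) = 2 ∑_{j=n+1}^∞ Cov(X₁, Xⱼ) = O(n^{-(r-2)/2})`, then
`sup_{m ≥ 0} E|S_{n+m} − S_m|^r ≤ B n^{r/2}` for some constant `B > 0`. -/
theorem birkel_moment_bound (μ : Measure Ω) [IsProbabilityMeasure μ]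
    (X : ℕ → Ω → ℝ) (hmeas : ∀ j, Measurable (X j))
    (hstat : StrictStationary μ X) (hassoc : IsAssociated μ X)
    (hmean : ∀ j : ℕ, 1 ≤ j → ∫ ω, X j ω ∂μ = 0)
    (C₁ : ℝ) (hbdd : ∀ j : ℕ, 1 ≤ j → ∀ ω, |X j ω| ≤ C₁)
    (r : ℝ) (hr : 2 < r)
    (hsum : Summable fun j : ℕ => cov μ (X 1) (X (j + 2)))
    (hu : ∃ K : ℝ, ∀ n : ℕ, 1 ≤ n →
      2 * ∑' i : ℕ, cov μ (X 1) (X (n + 1 + i)) ≤ K * (n : ℝ) ^ (-((r - 2) / 2))) :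
    ∃ B : ℝ, 0 < B ∧ ∀ n : ℕ, 1 ≤ n → ∀ m : ℕ,
      ∫ ω, |(∑ j ∈ Finset.Icc 1 (n + m), X j ω) - ∑ j ∈ Finset.Icc 1 m, X j ω| ^ r ∂μ ≤
        B * (n : ℝ) ^ (r / 2) := by
  obtain ⟨K, hK⟩ := hu
  set C := |C₁| with hC
  have hC0 : 0 ≤ C := abs_nonneg _
  have hbdd' : ∀ j : ℕ, 1 ≤ j → ∀ ω, |X j ω| ≤ C := fun j hj ω =>
    (hbdd j hj ω).trans (le_abs_self _)
  have hpos := hassoc.integral_mul_nonneg hmeas hmean hbdd'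
  have hcov : ∀ d, cov μ (X 1) (X (1 + d)) = ∫ ω, X 1 ω * X (1 + d) ω ∂μ := by
    intro d
    simp [cov, hmean 1 le_rfl]
  have hsum' : Summable fun d : ℕ => ∫ ω, X 1 ω * X (1 + d) ω ∂μ := by
    simp only [← hcov]
    refine (summable_nat_add_iff 1).1 ?_
    simpa only [show ∀ j, 1 + (j + 1) = j + 2 by lia] using hsum
  have hu' : ∀ d : ℕ, 1 ≤ d → ∑' l : ℕ, ∫ ω, X 1 ω * X (1 + (d + l)) ω ∂μ ≤
      |K| * (d : ℝ) ^ (-((r - 2) / 2)) := by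
    intro d hd
    have h1 := hK d hd
    have h2 : K * (d : ℝ) ^ (-((r - 2) / 2)) ≤ |K| * (d : ℝ) ^ (-((r - 2) / 2)) :=
      mul_le_mul_of_nonneg_right (le_abs_self K) (by positivity)
    have h3 : ∑' l : ℕ, ∫ ω, X 1 ω * X (1 + (d + l)) ω ∂μ =
        ∑' i : ℕ, cov μ (X 1) (X (d + 1 + i)) := by
      refine tsum_congr fun l => ?_
      rw [← hcov, show 1 + (d + l) = d + 1 + l by ring]
    have h4 : 0 ≤ ∑' l : ℕ, ∫ ω, X 1 ω * X (1 + (d + l)) ω ∂μ := tsum_nonneg fun l => hpos _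
    rw [h3] at h4 ⊢
    linarith
  set σ := ∑' d : ℕ, ∫ ω, X 1 ω * X (1 + d) ω ∂μ with hσ
  have hσ0 : 0 ≤ σ := tsum_nonneg hpos
  have mB := measurable_blockSum hmeas
  have bB := abs_blockSum_le hbdd'
  have hstat_pow : ∀ m n (s : ℝ),
      ∫ ω, |blockSum X m n ω| ^ s ∂μ = ∫ ω, |blockSum X 0 n ω| ^ s ∂μ := fun m n s =>
    hstat.integral_comp_blockSum hmeas m n (φ := fun x => |x| ^ s) (by fun_prop)
  have hint : ∀ {Y : Ω → ℝ} {R : ℝ}, Measurable Y → (∀ ω, |Y ω| ≤ R) →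
      Integrable (fun ω => |Y ω| ^ r) μ := by
    intro Y R hY hYR
    refine integrable_of_abs_le (C := R ^ r) (by fun_prop) fun ω => ?_
    rw [abs_of_nonneg (by positivity)]
    exact Real.rpow_le_rpow (abs_nonneg _) (hYR ω) (by linarith)
  have hmom : ∀ n : ℕ, ∫ ω, |blockSum X 0 n ω| ^ r ∂μ ≤ (C * n) ^ r := by
    intro n
    refine (integral_mono (hint (mB 0 n) (bB 0 n)) (integrable_const ((C * n) ^ r)) fun ω =>
      Real.rpow_le_rpow (abs_nonneg _) (bB 0 n ω) (by linarith)).trans_eq ?_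
    simp
  obtain ⟨B, hB, hBn⟩ := exists_le_mul_rpow_of_doubling (r := r)
    (M := fun n => ∫ ω, |blockSum X 0 n ω| ^ r ∂μ) hr hC0 hmom (by
    intro t ht0 ht1 q hq
    set κ := 2 * (r * 2 ^ (r - 1)) with hκ
    have hκ0 : 0 < κ := by positivity
    refine ⟨κ * ((t / κ) ^ (1 - r) * (2 * σ + 1) ^ r +
      (r - 1) * C ^ (r - 2) * |K| * (q : ℝ) ^ ((r - 2) / 2)), fun n k hn hnk => ?_⟩
    have hk : 1 ≤ k := Nat.pos_of_ne_zero (by rintro rfl; lia)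
    have hn0 : (0 : ℝ) < n := by exact_mod_cast hn
    have hk0 : (0 : ℝ) < k := by exact_mod_cast hk
    have hq0 : (0 : ℝ) < q := by exact_mod_cast hq
    set S := blockSum X 0 n with hS
    set T := blockSum X (n + k) n with hT
    have split : ∀ ω, blockSum X 0 (2 * n + k) ω = (S ω + T ω) + blockSum X n k ω := by
      intro ω
      rw [show 2 * n + k = n + k + n by ring, blockSum_add, blockSum_add, zero_add, zero_add]
      ring
    have hstep1 : ∫ ω, |blockSum X 0 (2 * n + k) ω| ^ r ∂μ ≤
        (1 - t) ^ (1 - r) * ∫ ω, |S ω + T ω| ^ r ∂μ +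
          t ^ (1 - r) * ∫ ω, |blockSum X 0 k ω| ^ r ∂μ := by
      have iST : Integrable (fun ω => |S ω + T ω| ^ r) μ :=
        hint (Y := fun ω => S ω + T ω) ((mB 0 n).add (mB (n + k) n)) fun ω =>
          (abs_add_le _ _).trans (add_le_add (bB 0 n ω) (bB (n + k) n ω))
      have iG := hint (mB n k) (bB n k)
      rw [← hstat_pow n k r, ← integral_const_mul, ← integral_const_mul,
        ← integral_add (iST.const_mul _) (iG.const_mul _)]
      refine integral_mono (hint (mB _ _) (bB _ _))
        ((iST.const_mul _).add (iG.const_mul _)) fun ω => ?_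
      simp only [split]
      exact abs_add_rpow_le_weighted _ _ (by linarith) ht0 ht1
    have hstep2 := integral_abs_add_rpow_le (μ := μ) (S := S) (T := T) (mB 0 n) (mB (n + k) n)
      (R := C * n) (by positivity) (bB 0 n) (bB (n + k) n)
      (fun φ ψ hφ hψ => hassoc.cov_comp_sum_nonneg hmeas (bB 0 n) (bB (n + k) n) hφ hψ)
      (hstat_pow (n + k) n)
      (integral_abs_blockSum_le hmeas hbdd' hn
        (integral_blockSum_sq_le hmeas hstat hbdd' hpos hsum' n)) hr (div_pos ht0 hκ0)
    have hcovST : cov μ S T ≤ n * (|K| * (k : ℝ) ^ (-((r - 2) / 2))) := by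
      have hS0 : ∫ ω, S ω ∂μ = 0 := by
        rw [hS]
        simp only [blockSum]
        rw [integral_finsetSum _ fun j hj => integrable_of_abs_le (hmeas j)
          (hbdd j (by rw [Finset.mem_Ico] at hj; lia))]
        exact Finset.sum_eq_zero fun j hj => hmean j (by rw [Finset.mem_Ico] at hj; lia)
      rw [cov, hS0, zero_mul, sub_zero]
      exact integral_blockSum_mul_blockSum_le hmeas hstat hbdd' hpos hsum' (abs_nonneg K)
        (by linarith) hu' n hk
    have hkn : (k : ℝ) ^ (-((r - 2) / 2)) ≤
        (q : ℝ) ^ ((r - 2) / 2) * (n : ℝ) ^ (-((r - 2) / 2)) := by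
      rw [← neg_neg ((r - 2) / 2), Real.rpow_neg hq0.le (-((r - 2) / 2)), neg_neg,
        ← div_eq_inv_mul, ← Real.div_rpow hn0.le hq0.le]
      refine Real.rpow_le_rpow_of_nonpos (by positivity) ?_ (by linarith)
      rw [div_le_iff₀ hq0, mul_comm]
      exact_mod_cast hnk
    have hnpow : (n : ℝ) ^ (r - 2) * (n * (n : ℝ) ^ (-((r - 2) / 2))) = (n : ℝ) ^ (r / 2) := by
      rw [mul_comm (n : ℝ), ← Real.rpow_add_one hn0.ne', ← Real.rpow_add hn0]
      congr 1; ring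
    have hcov2 : (r - 1) * (C * n) ^ (r - 2) * cov μ S T ≤
        (r - 1) * C ^ (r - 2) * |K| * (q : ℝ) ^ ((r - 2) / 2) * (n : ℝ) ^ (r / 2) := by
      have h1 := hcovST.trans (mul_le_mul_of_nonneg_left
        (mul_le_mul_of_nonneg_left hkn (abs_nonneg K)) hn0.le)
      have h2 : 0 ≤ (r - 1) * (C * n) ^ (r - 2) :=
        mul_nonneg (by linarith) (by positivity)
      refine (mul_le_mul_of_nonneg_left h1 h2).trans_eq ?_
      rw [← hnpow, Real.mul_rpow hC0 hn0.le]
      ring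
    have hbr : ((2 * σ + 1) * √(n : ℝ)) ^ r = (2 * σ + 1) ^ r * (n : ℝ) ^ (r / 2) := by
      rw [Real.mul_rpow (by positivity) (by positivity), Real.sqrt_eq_rpow,
        ← Real.rpow_mul hn0.le]
      congr 2; ring
    rw [← hσ, ← hκ, mul_div_cancel₀ _ hκ0.ne', hbr] at hstep2
    refine hstep1.trans (add_le_add (mul_le_mul_of_nonneg_left (hstep2.trans ?_)
      (Real.rpow_nonneg (by linarith) _)) le_rfl)
    have := mul_le_mul_of_nonneg_left hcov2 hκ0.le
    linarith)
  refine ⟨B, hB, fun n hn m => ?_⟩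
  refine le_trans (le_of_eq ?_) (hBn n hn)
  rw [← hstat_pow m n r]
  refine integral_congr_ae (ae_of_all _ fun ω => ?_)
  have e : ∀ N, ∑ j ∈ Finset.Icc 1 N, X j ω = blockSum X 0 N ω := by
    intro N
    rw [blockSum, zero_add, add_comm 1 N]
    rfl
  simp only [e]
  rw [add_comm n m, blockSum_add, zero_add, add_sub_cancel_left]
end
end

section
/- Let {X_n, n ≥ 1} be a strictly stationary sequence of associated random variables with |X_n| ≤ C_1 < ∞ for all n, such that X_1 has a bounded density. Then for every 0 < δ < 1/2 there exists a constant C such that for all indices 1 ≤ i < j and 1 ≤ k < l, |E( h^(2)(X_i, X_j) h^(2)(X_k, X_l) )| ≤ C ( Cov(X_i, X_j)^δ + Cov(X_i, X_k)^δ + Cov(X_i, X_l)^δ ), where h^(2) is the degenerate part of the Gini kernel. -/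
open MeasureTheory ProbabilityTheory Filter Topology

noncomputable section

variable {Ω : Type*} [MeasurableSpace Ω]

/-- `ρ₁(x) = ∫ |x − y| dF(y)` where `F` is the law of `X₁`. -/
def rho1 (μ : Measure Ω) (X1 : Ω → ℝ) (x : ℝ) : ℝ := ∫ y, |x - y| ∂(μ.map X1)

/-- Gini mean difference parameter `θ = ∫∫ |x − y| dF(x) dF(y)`. -/
def giniTheta (μ : Measure Ω) (X1 : Ω → ℝ) : ℝ := ∫ x, rho1 μ X1 x ∂(μ.map X1)

/-- Degenerate part of the Gini kernel: `h⁽²⁾(x,y) = |x−y| − ρ₁(x) − ρ₁(y) + θ`. -/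
def h2 (μ : Measure Ω) (X1 : Ω → ℝ) (x y : ℝ) : ℝ :=
  |x - y| - rho1 μ X1 x - rho1 μ X1 y + giniTheta μ X1

/-- `X` has a bounded probability density (w.r.t. Lebesgue measure). -/
def HasBddDensity (μ : Measure Ω) (X : Ω → ℝ) : Prop :=
  ∃ d : ℝ → ℝ, Measurable d ∧ (∃ M : ℝ, ∀ x, d x ≤ M) ∧ (∀ x, 0 ≤ d x) ∧
    μ.map X = volume.withDensity (fun x => ENNReal.ofReal (d x))

/-- The law of `X n` is that of `X 1`. -/
lemma StrictStationary.map_eq {μ : Measure Ω} {X : ℕ → Ω → ℝ} (hmeas : ∀ j, Measurable (X j))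
    (hstat : StrictStationary μ X) {n : ℕ} (hn : 1 ≤ n) : μ.map (X n) = μ.map (X 1) := by
  have h := congrArg (Measure.map (fun v : Fin 1 → ℝ => v 0)) (hstat (n - 1) 1)
  rw [Measure.map_map (by fun_prop) (by fun_prop), Measure.map_map (by fun_prop) (by fun_prop)] at h
  have hn' : 1 + (n - 1) = n := by omega
  simpa [Function.comp_def, hn'] using h

/-- A continuous function of a bounded random element is integrable. -/
lemma integrable_continuous_comp_of_bounded {Ω' E : Type*} [MeasurableSpace Ω'] {ν : Measure Ω'}
    [IsFiniteMeasure ν] [NormedAddCommGroup E] [ProperSpace E] [MeasurableSpace E] [BorelSpace E]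
    {U : Ω' → E} (hU : Measurable U) {A : ℝ} (hb : ∀ ω, ‖U ω‖ ≤ A) {f : E → ℝ}
    (hf : Continuous f) : Integrable (fun ω => f (U ω)) ν := by
  obtain ⟨K, hK⟩ := (isCompact_closedBall (0 : E) A).exists_bound_of_continuousOn hf.continuousOn
  refine Integrable.of_bound (hf.measurable.comp hU).aestronglyMeasurable K (ae_of_all _ fun ω => ?_)
  exact hK _ (by simpa using hb ω)

lemma sum_indicator_telescope (a : ℕ → ℝ) {p N : ℕ} (hp : p ≤ N) :
    a p = a 0 + ∑ m ∈ Finset.range N, (if m + 1 ≤ p then (1 : ℝ) else 0) * (a (m + 1) - a m) := by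
  have h : ∀ m, (if m + 1 ≤ p then (1 : ℝ) else 0) * (a (m + 1) - a m)
      = if m ∈ Finset.range p then a (m + 1) - a m else 0 := by
    intro m
    simp
  simp_rw [h]
  rw [Finset.sum_ite_mem, Finset.inter_eq_right.2 (Finset.range_subset_range.2 hp),
    Finset.sum_range_sub]
  ring

/-- If every nondecreasing function of `U` is nonnegatively correlated with every nondecreasing
function of `V`, then replacing `U` by a copy independent of `V` decreases the expectation of a
function with nondecreasing increments. -/
lemma integral_prod_le_of_supermodular {β : Type*} [NormedAddCommGroup β] [ProperSpace β]
    [MeasurableSpace β] [BorelSpace β] [Preorder β] {μ : Measure Ω} [IsProbabilityMeasure μ]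
    {U : Ω → ℝ} {V : Ω → β} (hU : Measurable U) (hV : Measurable V) {A : ℝ}
    (hUb : ∀ ω, |U ω| ≤ A) (hVb : ∀ ω, ‖V ω‖ ≤ A)
    (hUV : ∀ (h : ℝ → ℝ) (G : β → ℝ), Monotone h → Monotone G → Measurable h → Measurable G →
      Integrable (fun ω => h (U ω)) μ → Integrable (fun ω => G (V ω)) μ →
      Integrable (fun ω => h (U ω) * G (V ω)) μ →
      (∫ ω, h (U ω) ∂μ) * (∫ ω, G (V ω) ∂μ) ≤ ∫ ω, h (U ω) * G (V ω) ∂μ)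
    {f : ℝ × β → ℝ} (hf : Continuous f)
    (hsm : ∀ x x', x ≤ x' → Monotone fun v => f (x', v) - f (x, v)) :
    ∫ p, f (U p.1, V p.2) ∂(μ.prod μ) ≤ ∫ ω, f (U ω, V ω) ∂μ := by
  refine le_of_forall_pos_le_add fun ε hε => ?_
  have huc := (isCompact_closedBall (0 : ℝ × β) A).uniformContinuousOn_of_continuous hf.continuousOn
  rw [Metric.uniformContinuousOn_iff] at huc
  obtain ⟨d, hd, hfd⟩ := huc (ε / 2) (half_pos hε)
  set s : ℝ := d / 2 with hs
  have hs0 : 0 < s := half_pos hd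
  let p : ℝ → ℕ := fun x => ⌊(x + A) / s⌋₊
  let t : ℕ → ℝ := fun m => -A + m * s
  let N : ℕ := p A
  have hpm : Monotone p := fun x y hxy => Nat.floor_mono (by gcongr)
  have hpmeas : Measurable p := Nat.measurable_floor.comp (by fun_prop)
  have ht_le : ∀ x, |x| ≤ A → t (p x) ≤ x ∧ x < t (p x) + s ∧ |t (p x)| ≤ A := by
    intro x hx
    have hx' := abs_le.1 hx
    have h0 : 0 ≤ (x + A) / s := div_nonneg (by linarith) hs0.le
    have h1 := (le_div_iff₀ hs0).1 (Nat.floor_le h0)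
    have h2 := (div_lt_iff₀ hs0).1 (Nat.lt_floor_add_one ((x + A) / s))
    have h3 : (0 : ℝ) ≤ (⌊(x + A) / s⌋₊ : ℝ) * s := by positivity
    refine ⟨?_, ?_, abs_le.2 ⟨?_, ?_⟩⟩ <;> simp only [t, p] <;> linarith
  have hpN : ∀ ω, p (U ω) ≤ N := fun ω => hpm (abs_le.1 (hUb ω)).2
  have hT : Measurable fun ω => t (p (U ω)) :=
    (measurable_from_nat (f := t)).comp (hpmeas.comp hU)
  have hclose : ∀ ω ω', |f (t (p (U ω)), V ω') - f (U ω, V ω')| ≤ ε / 2 := by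
    intro ω ω'
    obtain ⟨h1, h2, h3⟩ := ht_le _ (hUb ω)
    refine (hfd (t (p (U ω)), V ω') ?_ (U ω, V ω') ?_ ?_).le
    · simpa [Prod.norm_def] using ⟨h3, hVb ω'⟩
    · simpa [Prod.norm_def] using ⟨hUb ω, hVb ω'⟩
    · rw [Prod.dist_eq]
      simp only [dist_self, Real.dist_eq]
      rw [max_eq_left (abs_nonneg _), abs_lt]
      constructor <;> linarith
  have hI1 : Integrable (fun ω => f (U ω, V ω)) μ :=
    integrable_continuous_comp_of_bounded (A := A) (hU.prodMk hV)
      (fun ω => by simpa [Prod.norm_def] using ⟨hUb ω, hVb ω⟩) hf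
  have hI2 : Integrable (fun q : Ω × Ω => f (U q.1, V q.2)) (μ.prod μ) :=
    integrable_continuous_comp_of_bounded (A := A) (U := fun q : Ω × Ω => (U q.1, V q.2))
      (by fun_prop) (fun q => by simpa [Prod.norm_def] using ⟨hUb q.1, hVb q.2⟩) hf
  have hJ1 : Integrable (fun ω => f (t (p (U ω)), V ω)) μ :=
    integrable_continuous_comp_of_bounded (A := A) (hT.prodMk hV)
      (fun ω => by simpa [Prod.norm_def] using ⟨(ht_le _ (hUb ω)).2.2, hVb ω⟩) hf
  have hJ2 : Integrable (fun q : Ω × Ω => f (t (p (U q.1)), V q.2)) (μ.prod μ) :=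
    integrable_continuous_comp_of_bounded (A := A)
      (U := fun q : Ω × Ω => (t (p (U q.1)), V q.2))
      ((hT.comp measurable_fst).prodMk (hV.comp measurable_snd))
      (fun q => by simpa [Prod.norm_def] using ⟨(ht_le _ (hUb q.1)).2.2, hVb q.2⟩) hf
  let χ : ℕ → ℝ → ℝ := fun m x => if m + 1 ≤ p x then 1 else 0
  let G : ℕ → β → ℝ := fun m v => f (t (m + 1), v) - f (t m, v)
  have hχm : ∀ m, Measurable (χ m) := fun m =>
    (measurable_from_nat (f := fun k => if m + 1 ≤ k then (1 : ℝ) else 0)).comp hpmeas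
  have hχmono : ∀ m, Monotone (χ m) := by
    intro m x y hxy
    have := hpm hxy
    simp only [χ]
    split_ifs <;> first | omega | norm_num
  have hχint : ∀ m, Integrable (fun ω => χ m (U ω)) μ := fun m =>
    Integrable.of_bound ((hχm m).comp hU).aestronglyMeasurable 1
      (ae_of_all _ fun ω => by simp only [χ]; split_ifs <;> simp)
  have hGc : ∀ m, Continuous (G m) := fun m => by fun_prop
  have hGint : ∀ m, Integrable (fun ω => G m (V ω)) μ := fun m =>
    integrable_continuous_comp_of_bounded hV hVb (hGc m)
  have hχG : ∀ m, Integrable (fun ω => χ m (U ω) * G m (V ω)) μ := fun m =>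
    (hGint m).bdd_mul (c := 1) ((hχm m).comp hU).aestronglyMeasurable
      (ae_of_all _ fun ω => by simp only [χ]; split_ifs <;> simp)
  have hGmono : ∀ m, Monotone (G m) := fun m => by
    simpa only [G, Nat.cast_add, Nat.cast_one] using
      hsm (t m) (t (m + 1)) (by simp only [t]; push_cast; nlinarith)
  have hexp : ∀ ω ω', f (t (p (U ω)), V ω')
      = f (t 0, V ω') + ∑ m ∈ Finset.range N, χ m (U ω) * G m (V ω') := fun ω ω' =>
    sum_indicator_telescope (fun m => f (t m, V ω')) (hpN ω)
  have hI0 : Integrable (fun ω => f (t 0, V ω)) μ :=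
    integrable_continuous_comp_of_bounded hV hVb (f := fun v => f (t 0, v)) (by fun_prop)
  have hstep : ∫ q, f (t (p (U q.1)), V q.2) ∂(μ.prod μ) ≤ ∫ ω, f (t (p (U ω)), V ω) ∂μ := by
    simp_rw [hexp]
    rw [integral_add (hI0.comp_snd μ)
        (integrable_finsetSum _ fun m _ => (hχint m).mul_prod (hGint m)),
      integral_add hI0 (integrable_finsetSum _ fun m _ => hχG m),
      integral_finsetSum _ fun m _ => (hχint m).mul_prod (hGint m),
      integral_finsetSum _ fun m _ => hχG m]
    refine add_le_add (le_of_eq ?_) (Finset.sum_le_sum fun m _ => ?_)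
    · have := integral_fun_snd (μ := μ) (ν := μ) (fun ω => f (t 0, V ω))
      simpa using this
    · rw [integral_prod_mul (fun ω => χ m (U ω)) (fun ω => G m (V ω))]
      exact hUV _ _ (hχmono m) (hGmono m) (hχm m) (hGc m).measurable (hχint m) (hGint m) (hχG m)
  have e1 : ∫ q, f (U q.1, V q.2) ∂(μ.prod μ)
      ≤ ∫ q, f (t (p (U q.1)), V q.2) ∂(μ.prod μ) + ε / 2 := by
    have : ∫ q, f (U q.1, V q.2) ∂(μ.prod μ)
        ≤ ∫ q, (f (t (p (U q.1)), V q.2) + ε / 2) ∂(μ.prod μ) :=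
      integral_mono hI2 (hJ2.add (integrable_const _)) fun q => by
        have := (abs_le.1 (hclose q.1 q.2)).1
        simp only
        linarith
    rwa [integral_add hJ2 (integrable_const _), integral_const, probReal_univ, one_smul] at this
  have e2 : ∫ ω, f (t (p (U ω)), V ω) ∂μ ≤ ∫ ω, f (U ω, V ω) ∂μ + ε / 2 := by
    have : ∫ ω, f (t (p (U ω)), V ω) ∂μ ≤ ∫ ω, (f (U ω, V ω) + ε / 2) ∂μ :=
      integral_mono hJ1 (hI1.add (integrable_const _)) fun ω => by
        have := (abs_le.1 (hclose ω ω)).2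
        simp only
        linarith
    rwa [integral_add hI1 (integrable_const _), integral_const, probReal_univ, one_smul] at this
  linarith

/-- Association gives nonnegative correlation between monotone functions of one coordinate and of
three others. -/
lemma IsAssociated.integral_mul_le {μ : Measure Ω} {X : ℕ → Ω → ℝ} (hassoc : IsAssociated μ X)
    (i j k l : ℕ) (h : ℝ → ℝ) (G : ℝ × ℝ × ℝ → ℝ) (hh : Monotone h) (hG : Monotone G)
    (hhm : Measurable h) (hGm : Measurable G) (hhi : Integrable (fun ω => h (X i ω)) μ)
    (hGi : Integrable (fun ω => G (X j ω, X k ω, X l ω)) μ)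
    (hhG : Integrable (fun ω => h (X i ω) * G (X j ω, X k ω, X l ω)) μ) :
    (∫ ω, h (X i ω) ∂μ) * (∫ ω, G (X j ω, X k ω, X l ω) ∂μ)
      ≤ ∫ ω, h (X i ω) * G (X j ω, X k ω, X l ω) ∂μ := by
  let S : Finset ℕ := {i, j, k, l}
  have hi : i ∈ S := by simp [S]
  have hj : j ∈ S := by simp [S]
  have hk : k ∈ S := by simp [S]
  have hl : l ∈ S := by simp [S]
  have := hassoc S (fun v => h (v ⟨i, hi⟩)) (fun v => G (v ⟨j, hj⟩, v ⟨k, hk⟩, v ⟨l, hl⟩))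
    (fun v w hvw => hh (hvw _)) (fun v w hvw => hG ⟨hvw _, hvw _, hvw _⟩)
    (by fun_prop) (by fun_prop) hhi hGi hhG
  unfold cov at this
  linarith

/-- Increments of a convex function are nondecreasing. -/
lemma ConvexOn.sub_le_sub_of_univ {φ : ℝ → ℝ} (hφ : ConvexOn ℝ Set.univ φ) {x x' y y' : ℝ}
    (hx : x ≤ x') (hy : y ≤ y') : φ (x' - y') - φ (x - y') ≤ φ (x' - y) - φ (x - y) := by
  rcases eq_or_lt_of_le (show x - y' ≤ x' - y by linarith) with h | h
  · obtain rfl : x = x' := by linarith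
    simp
  have hD : 0 < (x' - y) - (x - y') := by linarith
  set D := (x' - y) - (x - y') with hDdef
  have ha : 0 ≤ (x' - x) / D := div_nonneg (by linarith) hD.le
  have hb : 0 ≤ (y' - y) / D := div_nonneg (by linarith) hD.le
  have hab : (x' - x) / D + (y' - y) / D = 1 := by
    rw [← add_div, div_eq_one_iff_eq hD.ne']; ring
  have h1 := hφ.2 (Set.mem_univ (x' - y)) (Set.mem_univ (x - y')) ha hb hab
  have h2 := hφ.2 (Set.mem_univ (x - y')) (Set.mem_univ (x' - y)) ha hb hab
  have e1 : ((x' - x) / D) • (x' - y) + ((y' - y) / D) • (x - y') = x' - y' := by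
    simp only [smul_eq_mul]; field_simp; rw [hDdef]; ring
  have e2 : ((x' - x) / D) • (x - y') + ((y' - y) / D) • (x' - y) = x - y := by
    simp only [smul_eq_mul]; field_simp; rw [hDdef]; ring
  rw [e1] at h1
  rw [e2] at h2
  simp only [smul_eq_mul] at h1 h2
  have h3 : ((x' - x) / D) * (φ (x' - y) + φ (x - y')) + ((y' - y) / D) * (φ (x' - y) + φ (x - y'))
      = φ (x' - y) + φ (x - y') := by rw [← add_mul, hab, one_mul]
  linarith

lemma convexOn_abs_univ : ConvexOn ℝ Set.univ fun u : ℝ => |u| :=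
  convexOn_norm (E := ℝ) convex_univ

lemma convexOn_max_abs_sub_sq (ε : ℝ) : ConvexOn ℝ Set.univ fun u : ℝ => max (|u| - ε) 0 ^ 2 := by
  have h : ConvexOn ℝ Set.univ fun u : ℝ => max (|u| - ε) 0 :=
    (convexOn_abs_univ.sub (concaveOn_const ε convex_univ)).sup (convexOn_const 0 convex_univ)
  exact h.pow (fun _ _ => le_max_right _ _) 2

lemma sq_sub_max_abs_sub_sq_bounds {ε : ℝ} (hε : 0 < ε) (u : ℝ) :
    2 * ε * |u| - ε ^ 2 ≤ u ^ 2 - max (|u| - ε) 0 ^ 2 ∧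
      u ^ 2 - max (|u| - ε) 0 ^ 2 ≤ 2 * ε * |u| := by
  have h0 := abs_nonneg u
  rw [← sq_abs u]
  rcases le_total (|u| - ε) 0 with h | h
  · rw [max_eq_right h]; constructor <;> nlinarith [sq_nonneg (|u| - ε)]
  · rw [max_eq_left h]; constructor <;> nlinarith

lemma rho1_eq {μ : Measure Ω} {X1 : Ω → ℝ} (hX : Measurable X1) (x : ℝ) :
    rho1 μ X1 x = ∫ ω, |x - X1 ω| ∂μ :=
  integral_map hX.aemeasurable (by fun_prop)

section Gini

variable {μ : Measure Ω} [IsProbabilityMeasure μ] {X1 : Ω → ℝ} {A : ℝ}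

lemma integrable_abs_sub (hX : Measurable X1) (hb : ∀ ω, |X1 ω| ≤ A) (x : ℝ) :
    Integrable (fun ω => |x - X1 ω|) μ :=
  integrable_continuous_comp_of_bounded hX hb (f := fun y => |x - y|) (by fun_prop)

lemma rho1_sub_le (hX : Measurable X1) (hb : ∀ ω, |X1 ω| ≤ A) (x x' : ℝ) :
    rho1 μ X1 x - rho1 μ X1 x' ≤ |x - x'| := by
  rw [rho1_eq hX, rho1_eq hX,
    ← integral_sub (integrable_abs_sub hX hb x) (integrable_abs_sub hX hb x')]
  calc _ ≤ ∫ _, |x - x'| ∂μ := integral_mono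
        ((integrable_abs_sub hX hb x).sub (integrable_abs_sub hX hb x')) (integrable_const _)
        fun ω => by
          have := abs_sub_abs_le_abs_sub (x - X1 ω) (x' - X1 ω)
          simpa using this
    _ = |x - x'| := by simp

lemma continuous_rho1 (hX : Measurable X1) (hb : ∀ ω, |X1 ω| ≤ A) : Continuous (rho1 μ X1) :=
  (LipschitzWith.of_le_add_mul 1 fun x y => by
    have := rho1_sub_le (μ := μ) hX hb x y
    rw [Real.dist_eq]; push_cast; linarith).continuous

lemma continuous_h2 (hX : Measurable X1) (hb : ∀ ω, |X1 ω| ≤ A) :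
    Continuous fun p : ℝ × ℝ => h2 μ X1 p.1 p.2 := by
  have := continuous_rho1 (μ := μ) hX hb
  unfold h2
  fun_prop

lemma abs_h2_sub_le (hX : Measurable X1) (hb : ∀ ω, |X1 ω| ≤ A) (z w z' w' : ℝ) :
    |h2 μ X1 z w - h2 μ X1 z' w'| ≤ 2 * (|z - z'| + |w - w'|) := by
  have h1 := rho1_sub_le (μ := μ) hX hb z z'
  have h2' := rho1_sub_le (μ := μ) hX hb z' z
  have h3 := rho1_sub_le (μ := μ) hX hb w w'
  have h4 := rho1_sub_le (μ := μ) hX hb w' w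
  rw [abs_sub_comm] at h2' h4
  have h5 : |(|z - w| - |z' - w'|)| ≤ |z - z'| + |w - w'| := by
    refine (abs_abs_sub_abs_le_abs_sub _ _).trans ?_
    rw [show z - w - (z' - w') = (z - z') - (w - w') by ring]
    exact abs_sub _ _
  have h6 := abs_le.1 h5
  unfold h2
  exact abs_le.2 ⟨by linarith, by linarith⟩

/-- Degeneracy of the kernel. -/
lemma integral_h2_eq_zero (hX : Measurable X1) (hb : ∀ ω, |X1 ω| ≤ A) {Y : Ω → ℝ}
    (hY : Measurable Y) (hYb : ∀ ω, |Y ω| ≤ A) (hlaw : μ.map Y = μ.map X1) (y : ℝ) :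
    ∫ ω, h2 μ X1 (Y ω) y ∂μ = 0 := by
  have hc := continuous_rho1 (μ := μ) hX hb
  have i1 : Integrable (fun ω => |Y ω - y|) μ :=
    integrable_continuous_comp_of_bounded hY hYb (f := fun x => |x - y|) (by fun_prop)
  have i2 : Integrable (fun ω => rho1 μ X1 (Y ω)) μ :=
    integrable_continuous_comp_of_bounded hY hYb hc
  have e1 : ∫ ω, |Y ω - y| ∂μ = rho1 μ X1 y := by
    rw [rho1, ← hlaw, integral_map hY.aemeasurable (by fun_prop)]
    simp_rw [abs_sub_comm]
  have e2 : ∫ ω, rho1 μ X1 (Y ω) ∂μ = giniTheta μ X1 := by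
    rw [giniTheta, ← hlaw, integral_map hY.aemeasurable hc.aestronglyMeasurable]
  have := integral_add ((i1.sub i2).sub (integrable_const (rho1 μ X1 y)))
    (integrable_const (giniTheta μ X1))
  have h' := integral_sub (i1.sub i2) (integrable_const (rho1 μ X1 y))
  have h'' := integral_sub i1 i2
  simp only [Pi.sub_apply, integral_const, probReal_univ, one_smul] at this h' h''
  unfold h2
  linarith

end Gini

lemma integral_linear_combination_four {ν : Measure Ω} {a b c d : Ω → ℝ} (ha : Integrable a ν)
    (hb : Integrable b ν) (hc : Integrable c ν) (hd : Integrable d ν) (r₁ r₂ r₃ r₄ : ℝ) :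
    ∫ ω, (r₁ * a ω + r₂ * b ω + r₃ * c ω + r₄ * d ω) ∂ν
      = r₁ * ∫ ω, a ω ∂ν + r₂ * ∫ ω, b ω ∂ν + r₃ * ∫ ω, c ω ∂ν + r₄ * ∫ ω, d ω ∂ν := by
  have h₁₂ : Integrable (fun ω => r₁ * a ω + r₂ * b ω) ν := (ha.const_mul r₁).add (hb.const_mul r₂)
  have h₁₂₃ : Integrable (fun ω => r₁ * a ω + r₂ * b ω + r₃ * c ω) ν := h₁₂.add (hc.const_mul r₃)
  rw [integral_add h₁₂₃ (hd.const_mul r₄), integral_add h₁₂ (hc.const_mul r₃),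
    integral_add (ha.const_mul r₁) (hb.const_mul r₂)]
  simp only [integral_const_mul]

/-- Decoupling the two arguments of `|x - y|` costs at most the covariance over `ε`, plus `ε`. -/
lemma integral_prod_abs_sub_le {μ : Measure Ω} [IsProbabilityMeasure μ] {U Y : Ω → ℝ}
    (hU : Measurable U) (hY : Measurable Y) {A : ℝ}
    (hUb : ∀ ω, |U ω| ≤ A) (hYb : ∀ ω, |Y ω| ≤ A)
    (hUY : ∀ h G : ℝ → ℝ, Monotone h → Monotone G → Measurable h → Measurable G →
      Integrable (fun ω => h (U ω)) μ → Integrable (fun ω => G (Y ω)) μ →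
      Integrable (fun ω => h (U ω) * G (Y ω)) μ →
      (∫ ω, h (U ω) ∂μ) * (∫ ω, G (Y ω) ∂μ) ≤ ∫ ω, h (U ω) * G (Y ω) ∂μ)
    {ε : ℝ} (hε : 0 < ε) :
    2 * ε * (∫ p, |U p.1 - Y p.2| ∂(μ.prod μ) - ∫ ω, |U ω - Y ω| ∂μ)
      ≤ 2 * cov μ U Y + ε ^ 2 := by
  let φ : ℝ → ℝ := fun u => max (|u| - ε) 0 ^ 2
  have hφc : Continuous φ := by fun_prop
  have key := integral_prod_le_of_supermodular hU hY hUb hYb hUY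
    (f := fun p => -φ (p.1 - p.2)) (by fun_prop) (fun x x' hx y y' hy => by
      have := (convexOn_max_abs_sub_sq ε).sub_le_sub_of_univ hx hy
      simp only [φ]
      linarith)
  simp only [integral_neg] at key
  have I1 : ∀ {f : ℝ × ℝ → ℝ}, Continuous f → Integrable (fun ω => f (U ω, Y ω)) μ := fun hf =>
    integrable_continuous_comp_of_bounded (A := A) (hU.prodMk hY)
      (fun ω => by simpa [Prod.norm_def] using ⟨hUb ω, hYb ω⟩) hf
  have I2 : ∀ {f : ℝ × ℝ → ℝ}, Continuous f →
      Integrable (fun p : Ω × Ω => f (U p.1, Y p.2)) (μ.prod μ) := fun hf =>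
    integrable_continuous_comp_of_bounded (A := A) (U := fun p : Ω × Ω => (U p.1, Y p.2))
      (by fun_prop) (fun p => by simpa [Prod.norm_def] using ⟨hUb p.1, hYb p.2⟩) hf
  have sq1 : ∫ ω, (U ω - Y ω) ^ 2 ∂μ
      = ∫ ω, U ω ^ 2 ∂μ + ∫ ω, Y ω ^ 2 ∂μ - 2 * ∫ ω, U ω * Y ω ∂μ := by
    have i1 : Integrable (fun ω => U ω ^ 2) μ :=
      I1 (f := fun q => q.1 ^ 2) (by fun_prop)
    have i2 : Integrable (fun ω => Y ω ^ 2) μ :=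
      I1 (f := fun q => q.2 ^ 2) (by fun_prop)
    have i12 : Integrable (fun ω => U ω ^ 2 + Y ω ^ 2) μ := i1.add i2
    have i3 : Integrable (fun ω => 2 * (U ω * Y ω)) μ :=
      I1 (f := fun q => 2 * (q.1 * q.2)) (by fun_prop)
    rw [← integral_const_mul, ← integral_add i1 i2, ← integral_sub i12 i3]
    congr 1 with ω
    ring
  have sq2 : ∫ p, (U p.1 - Y p.2) ^ 2 ∂(μ.prod μ)
      = ∫ ω, U ω ^ 2 ∂μ + ∫ ω, Y ω ^ 2 ∂μ - 2 * ((∫ ω, U ω ∂μ) * ∫ ω, Y ω ∂μ) := by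
    have i1 : Integrable (fun p : Ω × Ω => U p.1 ^ 2) (μ.prod μ) :=
      I2 (f := fun q => q.1 ^ 2) (by fun_prop)
    have i2 : Integrable (fun p : Ω × Ω => Y p.2 ^ 2) (μ.prod μ) :=
      I2 (f := fun q => q.2 ^ 2) (by fun_prop)
    have i12 : Integrable (fun p : Ω × Ω => U p.1 ^ 2 + Y p.2 ^ 2) (μ.prod μ) := i1.add i2
    have i3 : Integrable (fun p : Ω × Ω => 2 * (U p.1 * Y p.2)) (μ.prod μ) :=
      I2 (f := fun q => 2 * (q.1 * q.2)) (by fun_prop)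
    have e1 := integral_fun_fst (μ := μ) (ν := μ) (fun ω => U ω ^ 2)
    have e2 := integral_fun_snd (μ := μ) (ν := μ) (fun ω => Y ω ^ 2)
    simp only [probReal_univ, one_smul] at e1 e2
    rw [← integral_prod_mul U Y, ← integral_const_mul, ← e1, ← e2, ← integral_add i1 i2,
      ← integral_sub i12 i3]
    congr 1 with ω
    ring
  have b1 : ∫ ω, ((U ω - Y ω) ^ 2 - φ (U ω - Y ω)) ∂μ ≤ ∫ ω, 2 * ε * |U ω - Y ω| ∂μ :=
    integral_mono (I1 (f := fun q => (q.1 - q.2) ^ 2 - φ (q.1 - q.2)) (by fun_prop))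
      (I1 (f := fun q => 2 * ε * |q.1 - q.2|) (by fun_prop))
      fun ω => (sq_sub_max_abs_sub_sq_bounds hε _).2
  have b2 : ∫ p, (2 * ε * |U p.1 - Y p.2| - ε ^ 2) ∂(μ.prod μ)
      ≤ ∫ p, ((U p.1 - Y p.2) ^ 2 - φ (U p.1 - Y p.2)) ∂(μ.prod μ) :=
    integral_mono (I2 (f := fun q => 2 * ε * |q.1 - q.2| - ε ^ 2) (by fun_prop))
      (I2 (f := fun q => (q.1 - q.2) ^ 2 - φ (q.1 - q.2)) (by fun_prop))
      fun p => (sq_sub_max_abs_sub_sq_bounds hε _).1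
  rw [integral_sub (I1 (f := fun q => (q.1 - q.2) ^ 2) (by fun_prop))
    (I1 (f := fun q => φ (q.1 - q.2)) (by fun_prop)), integral_const_mul] at b1
  rw [integral_sub (I2 (f := fun q => 2 * ε * |q.1 - q.2|) (by fun_prop)) (integrable_const _),
    integral_sub (I2 (f := fun q => (q.1 - q.2) ^ 2) (by fun_prop))
    (I2 (f := fun q => φ (q.1 - q.2)) (by fun_prop)), integral_const_mul, integral_const,
    probReal_univ, one_smul] at b2
  unfold cov
  linarith

section Decoupling

variable {μ : Measure Ω} [IsProbabilityMeasure μ] {X : ℕ → Ω → ℝ} {A : ℝ}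

lemma IsAssociated.cov_nonneg (hassoc : IsAssociated μ X) (hmeas : ∀ j, Measurable (X j))
    {i j : ℕ} (hi : ∀ ω, |X i ω| ≤ A) (hj : ∀ ω, |X j ω| ≤ A) : 0 ≤ cov μ (X i) (X j) := by
  have := hassoc.integral_mul_le i j j j id (fun v => v.1) monotone_id (fun _ _ h => h.1)
    measurable_id measurable_fst
    (integrable_continuous_comp_of_bounded (hmeas i) hi continuous_id)
    (integrable_continuous_comp_of_bounded (hmeas j) hj continuous_id)
    (integrable_continuous_comp_of_bounded (A := A) ((hmeas i).prodMk (hmeas j))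
      (fun ω => by simpa [Prod.norm_def] using ⟨hi ω, hj ω⟩) continuous_mul)
  unfold cov
  simpa using this

lemma cov_le_of_bounded {U Y : Ω → ℝ} (hU : ∀ ω, |U ω| ≤ A) (hY : ∀ ω, |Y ω| ≤ A) :
    cov μ U Y ≤ 2 * A ^ 2 := by
  have h1 : |∫ ω, U ω * Y ω ∂μ| ≤ A * A := by
    have := norm_integral_le_of_norm_le_const (μ := μ) (f := fun ω => U ω * Y ω) (C := A * A)
      (ae_of_all _ fun ω => by
        rw [norm_mul]
        exact mul_le_mul (hU ω) (hY ω) (norm_nonneg _) ((abs_nonneg _).trans (hU ω)))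
    simpa using this
  have h2 : |∫ ω, U ω ∂μ| ≤ A := by
    simpa using norm_integral_le_of_norm_le_const (μ := μ) (f := U) (ae_of_all _ hU)
  have h3 : |∫ ω, Y ω ∂μ| ≤ A := by
    simpa using norm_integral_le_of_norm_le_const (μ := μ) (f := Y) (ae_of_all _ hY)
  have h4 : |(∫ ω, U ω ∂μ) * ∫ ω, Y ω ∂μ| ≤ A * A := by
    rw [abs_mul]
    exact mul_le_mul h2 h3 (abs_nonneg _) ((abs_nonneg _).trans h2)
  unfold cov
  linarith [(abs_le.1 h1).2, (abs_le.1 h4).1]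

lemma IsAssociated.integral_prod_abs_sub_le_sqrt (hassoc : IsAssociated μ X)
    (hmeas : ∀ j, Measurable (X j)) {i j : ℕ} (hi : ∀ ω, |X i ω| ≤ A) (hj : ∀ ω, |X j ω| ≤ A) :
    ∫ p, |X i p.1 - X j p.2| ∂(μ.prod μ) - ∫ ω, |X i ω - X j ω| ∂μ
      ≤ 2 * √(cov μ (X i) (X j)) := by
  have key := fun ε (hε : (0 : ℝ) < ε) =>
    integral_prod_abs_sub_le (μ := μ) (hmeas i) (hmeas j) hi hj
      (fun h G hh hG hhm hGm hhi hGi hhG => hassoc.integral_mul_le i j j j h (fun v => G v.1) hh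
        (fun _ _ hv => hG hv.1) hhm (hGm.comp measurable_fst) hhi hGi hhG) hε
  set D := ∫ p, |X i p.1 - X j p.2| ∂(μ.prod μ) - ∫ ω, |X i ω - X j ω| ∂μ
  have hc : 0 ≤ cov μ (X i) (X j) := hassoc.cov_nonneg hmeas hi hj
  rcases hc.eq_or_lt with h0 | h0
  · rw [← h0, Real.sqrt_zero, mul_zero]
    by_contra! hD
    have := key D hD
    rw [← h0] at this
    nlinarith
  · have hs := Real.sqrt_pos.2 h0
    have := key _ hs
    rw [Real.sq_sqrt h0.le] at this
    nth_rewrite 2 [← Real.sq_sqrt h0.le] at this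
    nth_rewrite 3 [← Real.sq_sqrt h0.le] at this
    nlinarith

/-- Comparison of the expectation of a product of two degenerate kernels with its value, zero, for
decoupled arguments. -/
lemma IsAssociated.abs_integral_h2_mul_h2_le (hassoc : IsAssociated μ X)
    (hmeas : ∀ j, Measurable (X j)) {K : ℝ} {X1 : Ω → ℝ} (hX1 : Measurable X1)
    (hX1b : ∀ ω, |X1 ω| ≤ A) (hK : ∀ z w, |z| ≤ A → |w| ≤ A → |h2 μ X1 z w| ≤ K) {i j k l : ℕ}
    (hlaw : μ.map (X i) = μ.map X1)
    (hi : ∀ ω, |X i ω| ≤ A) (hj : ∀ ω, |X j ω| ≤ A) (hk : ∀ ω, |X k ω| ≤ A)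
    (hl : ∀ ω, |X l ω| ≤ A) :
    |∫ ω, h2 μ X1 (X i ω) (X j ω) * h2 μ X1 (X k ω) (X l ω) ∂μ| ≤
      K * (∫ p, |X i p.1 - X j p.2| ∂(μ.prod μ) - ∫ ω, |X i ω - X j ω| ∂μ)
        + 4 * (cov μ (X i) (X k) + cov μ (X i) (X l)) := by
  have hA : 0 ≤ A := by
    obtain ⟨ω⟩ := μ.nonempty_of_neZero
    exact (abs_nonneg _).trans (hi ω)
  let c : ℝ → ℝ := fun x => max (-A) (min A x)
  have hcc : Continuous c := by fun_prop
  have hcb : ∀ x, |c x| ≤ A := fun x =>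
    abs_le.2 ⟨le_max_left _ _, max_le (by linarith) (min_le_left _ _)⟩
  have hcid : ∀ x, |x| ≤ A → c x = x := fun x hx => by
    have := abs_le.1 hx
    simp only [c]
    rw [min_eq_right this.2, max_eq_right this.1]
  have hclip : ∀ x y, |c x - c y| ≤ |x - y| := fun x y => by
    have h1 := abs_max_sub_max_le_abs (min A x) (min A y) (-A)
    have h2 := abs_min_sub_min_le_max A x A y
    rw [sub_self, abs_zero, max_eq_right (abs_nonneg _)] at h2
    rw [max_comm, max_comm (min A y)] at h1
    exact h1.trans h2
  let g : ℝ → ℝ → ℝ := fun z w => h2 μ X1 (c z) (c w)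
  have hh2c := continuous_h2 (μ := μ) hX1 hX1b
  have hgc : Continuous fun q : ℝ × ℝ => g q.1 q.2 :=
    hh2c.comp ((hcc.comp continuous_fst).prodMk (hcc.comp continuous_snd))
  have hgb : ∀ z w, |g z w| ≤ K := fun z w => hK _ _ (hcb z) (hcb w)
  have hglip : ∀ z w z' w', |g z w - g z' w'| ≤ 2 * (|z - z'| + |w - w'|) := fun z w z' w' => by
    have := abs_h2_sub_le (μ := μ) hX1 hX1b (c z) (c w) (c z') (c w')
    linarith [hclip z z', hclip w w']
  have c1 : Continuous fun q : ℝ × ℝ × ℝ × ℝ => |q.1 - q.2.1| := by fun_prop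
  have c2 : Continuous fun q : ℝ × ℝ × ℝ × ℝ => q.1 * q.2.2.1 := by fun_prop
  have c3 : Continuous fun q : ℝ × ℝ × ℝ × ℝ => q.1 * q.2.2.2 := by fun_prop
  have c4 : Continuous fun q : ℝ × ℝ × ℝ × ℝ => h2 μ X1 q.1 q.2.1 * g q.2.2.1 q.2.2.2 :=
    (hh2c.comp (continuous_fst.prodMk (continuous_fst.comp continuous_snd))).mul
      (hgc.comp (continuous_snd.comp continuous_snd))
  let V : Ω → ℝ × ℝ × ℝ := fun ω => (X j ω, X k ω, X l ω)
  have hV : Measurable V := (hmeas j).prodMk ((hmeas k).prodMk (hmeas l))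
  have hVb : ∀ ω, ‖V ω‖ ≤ A := fun ω => by
    simpa [V, Prod.norm_def] using ⟨hj ω, hk ω, hl ω⟩
  have I1 : ∀ {f : ℝ × ℝ × ℝ × ℝ → ℝ}, Continuous f →
      Integrable (fun ω => f (X i ω, V ω)) μ := fun hf =>
    integrable_continuous_comp_of_bounded (A := A) ((hmeas i).prodMk hV)
      (fun ω => by rw [Prod.norm_mk]; exact max_le (hi ω) (hVb ω)) hf
  have I2 : ∀ {f : ℝ × ℝ × ℝ × ℝ → ℝ}, Continuous f →
      Integrable (fun p : Ω × Ω => f (X i p.1, V p.2)) (μ.prod μ) := fun hf =>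
    integrable_continuous_comp_of_bounded (A := A)
      (U := fun p : Ω × Ω => (X i p.1, V p.2))
      (((hmeas i).comp measurable_fst).prodMk (hV.comp measurable_snd))
      (fun p => by rw [Prod.norm_mk]; exact max_le (hi p.1) (hVb p.2)) hf
  have hdeg : ∫ p, h2 μ X1 (X i p.1) (X j p.2) * g (X k p.2) (X l p.2) ∂(μ.prod μ) = 0 := by
    rw [integral_prod_symm _ (I2 c4)]
    simp_rw [integral_mul_const, integral_h2_eq_zero hX1 hX1b (hmeas i) hi hlaw, zero_mul]
    exact integral_zero _ _
  have hgX : ∀ ω, g (X k ω) (X l ω) = h2 μ X1 (X k ω) (X l ω) := fun ω => by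
    simp only [g, hcid _ (hk ω), hcid _ (hl ω)]
  have key : ∀ σ : ℝ, |σ| ≤ 1 →
      -(σ * ∫ ω, h2 μ X1 (X i ω) (X j ω) * h2 μ X1 (X k ω) (X l ω) ∂μ) ≤
      K * (∫ p, |X i p.1 - X j p.2| ∂(μ.prod μ) - ∫ ω, |X i ω - X j ω| ∂μ)
        + 4 * (cov μ (X i) (X k) + cov μ (X i) (X l)) := by
    intro σ hσ
    have hJ := integral_prod_le_of_supermodular (hmeas i) hV hi hVb
      (hassoc.integral_mul_le i j k l)
      (f := fun q => -K * |q.1 - q.2.1| + 4 * (q.1 * q.2.2.1) + 4 * (q.1 * q.2.2.2)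
        + σ * (h2 μ X1 q.1 q.2.1 * g q.2.2.1 q.2.2.2)) (by fun_prop) (by
      rintro x x' hx ⟨y, z, w⟩ ⟨y', z', w'⟩ ⟨hy, hz, hw⟩
      simp only at hy hz hw ⊢
      have hconv := convexOn_abs_univ.sub_le_sub_of_univ hx hy
      have hb := abs_h2_sub_le (μ := μ) hX1 hX1b x' y x y
      have hg := hglip z' w' z w
      have hgK := hgb z' w'
      rw [sub_self, abs_zero, add_zero, abs_of_nonneg (sub_nonneg.2 hx)] at hb
      rw [abs_of_nonneg (sub_nonneg.2 hz), abs_of_nonneg (sub_nonneg.2 hw)] at hg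
      set e := (|x' - y| - |x - y|) - (|x' - y'| - |x - y'|) with he
      have he0 : 0 ≤ e := sub_nonneg.2 hconv
      have hdiff : h2 μ X1 x' y' - h2 μ X1 x y' = h2 μ X1 x' y - h2 μ X1 x y - e := by
        simp only [h2, he]; ring
      have t1 : |σ * (e * g z' w')| ≤ e * K := by
        rw [abs_mul, abs_mul, abs_of_nonneg he0]
        have := mul_le_mul_of_nonneg_left hgK he0
        nlinarith [mul_nonneg he0 (abs_nonneg (g z' w'))]
      have t2 : |σ * ((h2 μ X1 x' y - h2 μ X1 x y) * (g z' w' - g z w))|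
          ≤ 2 * (x' - x) * (2 * (z' - z + (w' - w))) := by
        rw [abs_mul, abs_mul]
        have := mul_le_mul hb hg (abs_nonneg _) (by linarith)
        have h0 := mul_nonneg (abs_nonneg (h2 μ X1 x' y - h2 μ X1 x y))
          (abs_nonneg (g z' w' - g z w))
        nlinarith
      have t1' := (abs_le.1 t1).2
      have t2' := (abs_le.1 t2).1
      have hmain : σ * (h2 μ X1 x' y' * g z' w') - σ * (h2 μ X1 x y' * g z' w')
          = σ * (h2 μ X1 x' y * g z w) - σ * (h2 μ X1 x y * g z w)
            + σ * ((h2 μ X1 x' y - h2 μ X1 x y) * (g z' w' - g z w)) - σ * (e * g z' w') := by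
        linear_combination σ * g z' w' * hdiff
      have hKe : e * K = K * (|x' - y| - |x - y|) - K * (|x' - y'| - |x - y'|) := by
        rw [he]; ring
      nlinarith)
    simp only at hJ
    rw [integral_linear_combination_four (I2 c1) (I2 c2) (I2 c3) (I2 c4),
      integral_linear_combination_four (I1 c1) (I1 c2) (I1 c3) (I1 c4)] at hJ
    simp only [V, hgX] at hJ hdeg
    rw [hdeg] at hJ
    rw [integral_prod_mul (X i) (X k), integral_prod_mul (X i) (X l)] at hJ
    unfold cov
    linarith
  refine abs_le.2 ⟨?_, ?_⟩
  · linarith [key 1 (by simp)]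
  · linarith [key (-1) (by simp)]

end Decoupling

lemma rpow_le_rpow_mul_rpow_sub {x B δ s : ℝ} (hx : 0 ≤ x) (hxB : x ≤ B) (hδ : 0 ≤ δ)
    (hδs : δ ≤ s) : x ^ s ≤ x ^ δ * B ^ (s - δ) := by
  have h : x ^ s = x ^ δ * x ^ (s - δ) := by
    rw [← Real.rpow_add_of_nonneg hx hδ (sub_nonneg.2 hδs), add_sub_cancel]
  rw [h]
  exact mul_le_mul_of_nonneg_left (Real.rpow_le_rpow hx hxB (sub_nonneg.2 hδs))
    (Real.rpow_nonneg hx _)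

/-- Key covariance bound from Lemma 3.1: for a bounded stationary associated sequence
whose marginal has a bounded density, for every `0 < δ < 1/2` there is `C` with
`|E(h⁽²⁾(X_i,X_j) h⁽²⁾(X_k,X_l))| ≤ C (Cov(X_i,X_j)^δ + Cov(X_i,X_k)^δ + Cov(X_i,X_l)^δ)`. -/
theorem h2_cov_bound (μ : Measure Ω) [IsProbabilityMeasure μ]
    (X : ℕ → Ω → ℝ) (hmeas : ∀ j, Measurable (X j))
    (hstat : StrictStationary μ X) (hassoc : IsAssociated μ X)
    (C₁ : ℝ) (hbdd : ∀ n : ℕ, 1 ≤ n → ∀ ω, |X n ω| ≤ C₁)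
    (hdens : HasBddDensity μ (X 1))
    (δ : ℝ) (hδ0 : 0 < δ) (hδ : δ < 1 / 2) :
    ∃ C : ℝ, ∀ i j k l : ℕ, 1 ≤ i → i < j → 1 ≤ k → k < l →
      |∫ ω, h2 μ (X 1) (X i ω) (X j ω) * h2 μ (X 1) (X k ω) (X l ω) ∂μ| ≤
        C * (cov μ (X i) (X j) ^ δ + cov μ (X i) (X k) ^ δ + cov μ (X i) (X l) ^ δ) := by
  have hX1b := hbdd 1 le_rfl
  obtain ⟨K, hK⟩ := (isCompact_closedBall (0 : ℝ × ℝ) C₁).exists_bound_of_continuousOn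
    (continuous_h2 (μ := μ) (hmeas 1) hX1b).continuousOn
  have hK' : ∀ z w, |z| ≤ C₁ → |w| ≤ C₁ → |h2 μ (X 1) z w| ≤ K := fun z w hz hw =>
    hK (z, w) (by simpa [Prod.norm_def] using ⟨hz, hw⟩)
  have hK0 : 0 ≤ K := by
    obtain ⟨ω⟩ := μ.nonempty_of_neZero
    exact (abs_nonneg _).trans (hK' _ _ (hX1b ω) (hX1b ω))
  set B : ℝ := 2 * C₁ ^ 2
  have hB : 0 ≤ B := by positivity
  refine ⟨2 * K * B ^ (1 / 2 - δ) + 4 * B ^ (1 - δ), fun i j k l hi hij hk hkl => ?_⟩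
  have bi := hbdd i hi
  have bj := hbdd j (by omega)
  have bk := hbdd k hk
  have bl := hbdd l (by omega)
  have main := hassoc.abs_integral_h2_mul_h2_le hmeas (hmeas 1) hX1b hK'
    (hstat.map_eq hmeas hi) bi bj bk bl
  have hD := mul_le_mul_of_nonneg_left
    (hassoc.integral_prod_abs_sub_le_sqrt hmeas bi bj) hK0
  have pj := hassoc.cov_nonneg hmeas bi bj
  have pk := hassoc.cov_nonneg hmeas bi bk
  have pl := hassoc.cov_nonneg hmeas bi bl
  have ej := rpow_le_rpow_mul_rpow_sub pj (cov_le_of_bounded bi bj) hδ0.le hδ.le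
  have ek := rpow_le_rpow_mul_rpow_sub pk (cov_le_of_bounded bi bk) hδ0.le
    (show δ ≤ 1 by linarith)
  have el := rpow_le_rpow_mul_rpow_sub pl (cov_le_of_bounded bi bl) hδ0.le
    (show δ ≤ 1 by linarith)
  rw [← Real.sqrt_eq_rpow] at ej
  rw [Real.rpow_one] at ek el
  have ej' := mul_le_mul_of_nonneg_left ej (mul_nonneg zero_le_two hK0)
  have qj := Real.rpow_nonneg pj δ
  have qk := Real.rpow_nonneg pk δ
  have ql := Real.rpow_nonneg pl δ
  have r1 : 0 ≤ 2 * K * B ^ (1 / 2 - δ) := by positivity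
  have r2 : 0 ≤ 4 * B ^ (1 - δ) := by positivity
  have s1 := mul_nonneg r1 (add_nonneg qk ql)
  have s2 := mul_nonneg r2 qj
  linarith
end
end

section
/- Let r : ℕ → [0, ∞) be a sequence with Σ_{j=1}^∞ r(j) < ∞ and r(0) < ∞. For integers i, j, k, l define Δ(i, j, k, l) = r(|i−j|)r(|k−i|) + r(|i−j|)r(|k−j|) + r(|i−j|)r(|k−l|) + r(|i−j|)r(|i−l|) + r(|i−k|)r(|j−k|) + r(|i−l|)r(|j−k|) + r(|j−l|)r(|j−i|) + r(|k−i|)r(|j−l|) + r(|i−l|)r(|j−l|). Then Σ_{1 ≤ i < j ≤ n} Σ_{1 ≤ k < l ≤ n} Δ(i, j, k, l) = o(n³) as n → ∞. -/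
open Filter Topology

noncomputable section

/-- The quantity `Δ(i,j,k,l)` built from the nonnegative sequence `r`. -/
def Delta (r : ℕ → ℝ) (i j k l : ℕ) : ℝ :=
  r (Nat.dist i j) * r (Nat.dist k i) + r (Nat.dist i j) * r (Nat.dist k j) +
    r (Nat.dist i j) * r (Nat.dist k l) + r (Nat.dist i j) * r (Nat.dist i l) +
    r (Nat.dist i k) * r (Nat.dist j k) + r (Nat.dist i l) * r (Nat.dist j k) +
    r (Nat.dist j l) * r (Nat.dist j i) + r (Nat.dist k i) * r (Nat.dist j l) +
    r (Nat.dist i l) * r (Nat.dist j l)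

/-- The terms of a nonnegative summable sequence, sampled at the distances from a fixed point to
the points of a finite set, have sum at most twice the total. -/
lemma sum_dist_le_two_mul_tsum (r : ℕ → ℝ) (hr : ∀ j, 0 ≤ r j) (hsum : Summable r)
    (s : Finset ℕ) (a : ℕ) : ∑ x ∈ s, r (Nat.dist a x) ≤ 2 * ∑' j, r j := by
  classical
  have key : ∀ t : Finset ℕ, Set.InjOn (Nat.dist a) t →
      ∑ x ∈ t, r (Nat.dist a x) ≤ ∑' j, r j := fun t ht => by
    rw [← Finset.sum_image (f := r) ht]
    exact hsum.sum_le_tsum _ fun j _ => hr j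
  rw [← Finset.sum_filter_add_sum_filter_not s (fun x => x < a), two_mul]
  refine add_le_add (key _ ?_) (key _ ?_) <;>
  · intro x hx y hy h
    simp only [Finset.coe_filter, Set.mem_ofPred_eq, Nat.dist] at hx hy h
    omega

/-- Iterated summation bound for a product in which each factor involves one more variable. -/
lemma sum_prod_le (s : Finset ℕ) (p : ℕ → ℕ → ℝ) (q : ℕ → ℕ → ℕ → ℝ)
    (t : ℕ → ℕ → ℕ → ℕ → ℝ) (b c d : ℝ) (hc : 0 ≤ c) (hd : 0 ≤ d)
    (hp : ∀ i j, 0 ≤ p i j) (hq : ∀ i j k, 0 ≤ q i j k)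
    (hb' : ∀ i, ∑ j ∈ s, p i j ≤ b) (hc' : ∀ i j, ∑ k ∈ s, q i j k ≤ c)
    (hd' : ∀ i j k, ∑ l ∈ s, t i j k l ≤ d) :
    ∑ i ∈ s, ∑ j ∈ s, ∑ k ∈ s, ∑ l ∈ s, p i j * q i j k * t i j k l
      ≤ s.card * (b * c * d) := by
  rw [← nsmul_eq_mul]
  refine Finset.sum_le_card_nsmul _ _ _ fun i _ => ?_
  calc ∑ j ∈ s, ∑ k ∈ s, ∑ l ∈ s, p i j * q i j k * t i j k l
      ≤ ∑ j ∈ s, ∑ k ∈ s, p i j * q i j k * d := by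
        refine Finset.sum_le_sum fun j _ => Finset.sum_le_sum fun k _ => ?_
        rw [← Finset.mul_sum]
        exact mul_le_mul_of_nonneg_left (hd' i j k) (mul_nonneg (hp i j) (hq i j k))
    _ ≤ ∑ j ∈ s, p i j * c * d := by
        refine Finset.sum_le_sum fun j _ => ?_
        rw [← Finset.sum_mul, ← Finset.mul_sum]
        exact mul_le_mul_of_nonneg_right (mul_le_mul_of_nonneg_left (hc' i j) (hp i j)) hd
    _ ≤ b * c * d := by
        rw [← Finset.sum_mul, ← Finset.sum_mul]
        exact mul_le_mul_of_nonneg_right (mul_le_mul_of_nonneg_right (hb' i) hc) hd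

lemma Delta_nonneg (r : ℕ → ℝ) (hr : ∀ j, 0 ≤ r j) (i j k l : ℕ) : 0 ≤ Delta r i j k l := by
  unfold Delta
  have := fun a b => mul_nonneg (hr a) (hr b)
  repeat' first | exact this _ _ | apply add_nonneg

/-- The sum of `Delta` over a finite box grows at most quadratically in the side of the box. -/
lemma sum_Delta_le (r : ℕ → ℝ) (hr : ∀ j, 0 ≤ r j) (hsum : Summable r) (s : Finset ℕ) :
    ∑ i ∈ s, ∑ j ∈ s, ∑ k ∈ s, ∑ l ∈ s, Delta r i j k l
      ≤ 9 * (2 * ∑' j, r j) ^ 2 * (s.card : ℝ) ^ 2 := by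
  set B := 2 * ∑' j, r j with hB
  set N : ℝ := (s.card : ℝ) with hN
  have hB0 : 0 ≤ B := mul_nonneg zero_le_two (tsum_nonneg hr)
  have hN0 : 0 ≤ N := Nat.cast_nonneg _
  have hf : ∀ a, ∑ x ∈ s, r (Nat.dist a x) ≤ B := sum_dist_le_two_mul_tsum r hr hsum s
  have h1 : ∑ _x ∈ s, (1 : ℝ) ≤ N := by simp [hN]
  have h01 : (0 : ℝ) ≤ 1 := zero_le_one
  -- The factor indexed by each variable is either `1` or `r` at the distance to an earlier one.
  have ij_ik := sum_prod_le s (fun i j => r (Nat.dist i j)) (fun i _ k => r (Nat.dist i k))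
    (fun _ _ _ _ => 1) B B N hB0 hN0 (fun _ _ => hr _) (fun _ _ _ => hr _)
    (fun _ => hf _) (fun _ _ => hf _) (fun _ _ _ => h1)
  have ij_jk := sum_prod_le s (fun i j => r (Nat.dist i j)) (fun _ j k => r (Nat.dist j k))
    (fun _ _ _ _ => 1) B B N hB0 hN0 (fun _ _ => hr _) (fun _ _ _ => hr _)
    (fun _ => hf _) (fun _ _ => hf _) (fun _ _ _ => h1)
  have ij_kl := sum_prod_le s (fun i j => r (Nat.dist i j)) (fun _ _ _ => 1)
    (fun _ _ k l => r (Nat.dist k l)) B N B hN0 hB0 (fun _ _ => hr _) (fun _ _ _ => h01)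
    (fun _ => hf _) (fun _ _ => h1) (fun _ _ _ => hf _)
  have ij_il := sum_prod_le s (fun i j => r (Nat.dist i j)) (fun _ _ _ => 1)
    (fun i _ _ l => r (Nat.dist i l)) B N B hN0 hB0 (fun _ _ => hr _) (fun _ _ _ => h01)
    (fun _ => hf _) (fun _ _ => h1) (fun _ _ _ => hf _)
  have ij_jl := sum_prod_le s (fun i j => r (Nat.dist i j)) (fun _ _ _ => 1)
    (fun _ j _ l => r (Nat.dist j l)) B N B hN0 hB0 (fun _ _ => hr _) (fun _ _ _ => h01)
    (fun _ => hf _) (fun _ _ => h1) (fun _ _ _ => hf _)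
  have il_jk := sum_prod_le s (fun _ _ => 1) (fun _ j k => r (Nat.dist j k))
    (fun i _ _ l => r (Nat.dist i l)) N B B hB0 hB0 (fun _ _ => h01) (fun _ _ _ => hr _)
    (fun _ => h1) (fun _ _ => hf _) (fun _ _ _ => hf _)
  have ik_jl := sum_prod_le s (fun _ _ => 1) (fun i _ k => r (Nat.dist i k))
    (fun _ j _ l => r (Nat.dist j l)) N B B hB0 hB0 (fun _ _ => h01) (fun _ _ _ => hr _)
    (fun _ => h1) (fun _ _ => hf _) (fun _ _ _ => hf _)
  have ik_jk : ∑ i ∈ s, ∑ j ∈ s, ∑ k ∈ s, ∑ _l ∈ s, r (Nat.dist i k) * r (Nat.dist j k)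
      ≤ N * (B * B * N) := by
    refine le_trans (le_of_eq ?_) ij_jk
    refine Finset.sum_congr rfl fun i _ => ?_
    rw [Finset.sum_comm]
    simp only [mul_one, Nat.dist_comm]
  have il_jl : ∑ i ∈ s, ∑ j ∈ s, ∑ _k ∈ s, ∑ l ∈ s, r (Nat.dist i l) * r (Nat.dist j l)
      ≤ N * (B * B * N) := by
    refine le_trans (le_of_eq ?_) ik_jk
    refine Finset.sum_congr rfl fun i _ => Finset.sum_congr rfl fun j _ => ?_
    rw [Finset.sum_comm]
  simp only [mul_one, one_mul] at ij_ik ij_jk ij_kl ij_il ij_jl il_jk ik_jl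
  have hD : ∀ i j k l, Delta r i j k l =
      r (Nat.dist i j) * r (Nat.dist i k) + r (Nat.dist i j) * r (Nat.dist j k) +
      r (Nat.dist i j) * r (Nat.dist k l) + r (Nat.dist i j) * r (Nat.dist i l) +
      r (Nat.dist i k) * r (Nat.dist j k) + r (Nat.dist j k) * r (Nat.dist i l) +
      r (Nat.dist i j) * r (Nat.dist j l) + r (Nat.dist i k) * r (Nat.dist j l) +
      r (Nat.dist i l) * r (Nat.dist j l) := fun i j k l => by
    rw [Delta, Nat.dist_comm k i, Nat.dist_comm k j, Nat.dist_comm j i]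
    ring
  simp only [hD, Finset.sum_add_distrib]
  linarith

/-- Deterministic summability estimate (display (3.10)): if `r ≥ 0` and
`∑_{j=1}^∞ r(j) < ∞`, then `∑_{1 ≤ i < j ≤ n} ∑_{1 ≤ k < l ≤ n} Δ(i,j,k,l) = o(n³)`. -/
theorem delta_sum_little_o (r : ℕ → ℝ) (hr : ∀ j, 0 ≤ r j)
    (hsum : Summable fun j : ℕ => r (j + 1)) :
    Tendsto (fun n : ℕ =>
        (∑ i ∈ Finset.Icc 1 n, ∑ j ∈ Finset.Icc (i + 1) n,
          ∑ k ∈ Finset.Icc 1 n, ∑ l ∈ Finset.Icc (k + 1) n, Delta r i j k l) / (n : ℝ) ^ 3)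
      atTop (𝓝 0) := by
  have hs : Summable r := (summable_nat_add_iff 1).1 hsum
  set C := 9 * (2 * ∑' j, r j) ^ 2
  have h0 := Delta_nonneg r hr
  have hlim : Tendsto (fun n : ℕ => C / (n : ℝ)) atTop (𝓝 0) :=
    tendsto_const_div_atTop_nhds_zero_nat C
  refine squeeze_zero' (.of_forall fun n => ?_) ?_ hlim
  · exact div_nonneg (Finset.sum_nonneg fun i _ => Finset.sum_nonneg fun j _ =>
      Finset.sum_nonneg fun k _ => Finset.sum_nonneg fun l _ => h0 i j k l) (by positivity)
  filter_upwards [eventually_gt_atTop 0] with n hn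
  have hn' : (0 : ℝ) < n := Nat.cast_pos.2 hn
  have hsub : ∀ i, Finset.Icc (i + 1) n ⊆ Finset.Icc 1 n := fun i =>
    Finset.Icc_subset_Icc_left (Nat.le_add_left 1 i)
  have hbox := sum_Delta_le r hr hs (Finset.Icc 1 n)
  rw [Nat.card_Icc, Nat.add_sub_cancel] at hbox
  rw [div_le_div_iff₀ (by positivity) hn']
  calc _ ≤ (C * (n : ℝ) ^ 2) * n := by
        refine mul_le_mul_of_nonneg_right (le_trans ?_ hbox) hn'.le
        refine Finset.sum_le_sum fun i _ => ?_
        refine le_trans (Finset.sum_le_sum fun j _ => Finset.sum_le_sum fun k _ =>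
          Finset.sum_le_sum_of_subset_of_nonneg (hsub k) fun l _ _ => h0 i j k l) ?_
        exact Finset.sum_le_sum_of_subset_of_nonneg (hsub i) fun j _ _ =>
          Finset.sum_nonneg fun k _ => Finset.sum_nonneg fun l _ => h0 i j k l
    _ = C * (n : ℝ) ^ 3 := by ring
end
end
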